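/- arXiv:2112.06828 — 3 statements merged into one kernel-verified Lean document; each statement's English description precedes it below -/
import Mathlib

section
/- Let X be a set equipped with the cofinite topology. Then X is a Noetherian space, and its sobrification rank is: 0 if X is empty, 1 if X is finite and nonempty, and 2 if X is infinite. -/
open TopologicalSpace

/-- The ordinal rank of an element of a poset: defined by well-founded recursion as the least
ordinal strictly greater than the ranks of all strictly smaller elements (and `0` as a junk
value if the strict order is not well-founded). -/
noncomputable def wfRank {α : Type*} [Preorder α] (a : α) : Ordinal :=
  open Classical in
  if h : WellFoundedLT α then @IsWellFounded.rank α (· < ·) h a else 0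

/-- The ordinal rank of a poset: the least ordinal strictly greater than the ranks of
all its elements. -/
noncomputable def ordRank (α : Type*) [Preorder α] : Ordinal :=
  ⨆ a : α, wfRank a + 1

/-- The stature of a topological space: the rank of the whole space in the poset of
closed subsets ordered by inclusion (equivalently, the ordinal rank of the poset of proper
closed subsets). -/
noncomputable def stature (X : Type*) [TopologicalSpace X] : Ordinal :=
  wfRank (⊤ : Closeds X)

/-- The sobrification rank of a topological space: the ordinal rank of the poset of
irreducible closed subsets ordered by inclusion. -/
noncomputable def sobRank (X : Type*) [TopologicalSpace X] : Ordinal :=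
  ordRank (IrreducibleCloseds X)

theorem wfRank_lt_wfRank {α : Type*} [Preorder α] [h : WellFoundedLT α] {a b : α} (hab : a < b) :
    wfRank a < wfRank b := by
  simpa only [wfRank, dif_pos h] using WellFoundedLT.rank_strictMono hab

theorem wfRank_le_of_forall_lt {α : Type*} [Preorder α] {a : α} {o : Ordinal}
    (ho : ∀ b < a, wfRank b < o) : wfRank a ≤ o := by
  by_cases h : WellFoundedLT α
  · simp only [wfRank, dif_pos h] at ho ⊢
    rw [IsWellFounded.rank_eq]
    exact Ordinal.iSup_le fun b => Order.succ_le_of_lt (ho b b.2)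
  · simp [wfRank, h]

theorem IsMin.wfRank_eq_zero {α : Type*} [Preorder α] {a : α} (ha : IsMin a) : wfRank a = 0 :=
  nonpos_iff_eq_zero.mp <| wfRank_le_of_forall_lt fun _ hb => (ha.not_lt hb).elim

theorem wfRank_lt_ordRank {α : Type*} [Preorder α] (a : α) : wfRank a < ordRank α :=
  Ordinal.lt_iSup_add_one _ a

theorem ordRank_le_of_forall_lt {α : Type*} [Preorder α] {o : Ordinal}
    (ho : ∀ a : α, wfRank a < o) : ordRank α ≤ o :=
  Ordinal.iSup_add_one_le ho

theorem IsIrreducible.eq_singleton_of_finite {X : Type*} [TopologicalSpace X] [T1Space X]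
    {s : Set X} (hs : IsIrreducible s) (hfin : s.Finite) : ∃ x, s = {x} := by
  classical
  obtain ⟨z, hz, hsz⟩ := isIrreducible_iff_sUnion_isClosed.mp hs
    (hfin.toFinset.image fun x => {x}) (by simp) (by intro x hx; simpa using hx)
  obtain ⟨x, -, rfl⟩ := Finset.mem_image.mp hz
  exact ⟨x, (hs.nonempty.subset_singleton_iff).mp hsz⟩

namespace TopologicalSpace.IrreducibleCloseds

variable {X : Type*} [TopologicalSpace X]

instance [NoetherianSpace X] : WellFoundedLT (IrreducibleCloseds X) :=
  StrictMono.wellFoundedLT (f := fun s : IrreducibleCloseds X => (⟨s, s.isClosed⟩ : Closeds X))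
    fun _ _ h => h

theorem isMin_of_finite [T1Space X] {s : IrreducibleCloseds X} (hs : (s : Set X).Finite) :
    IsMin s := by
  obtain ⟨x, hx⟩ := s.isIrreducible.eq_singleton_of_finite hs
  intro t hts
  have hts' : (t : Set X) ⊆ {x} := hx ▸ hts
  exact (IrreducibleCloseds.ext
    (hx.trans ((t.isIrreducible.nonempty.subset_singleton_iff).mp hts').symm)).le

end TopologicalSpace.IrreducibleCloseds

theorem wfRank_irreducibleCloseds_cofinite_le_one {X : Type*}
    (s : IrreducibleCloseds (CofiniteTopology X)) : wfRank s ≤ 1 := by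
  refine wfRank_le_of_forall_lt fun t hts => ?_
  obtain ht | ht := CofiniteTopology.isClosed_iff.mp t.isClosed
  · have hst : (s : Set (CofiniteTopology X)) ⊆ t := ht ▸ Set.subset_univ _
    exact (hts.not_ge hst).elim
  · rw [(IrreducibleCloseds.isMin_of_finite ht).wfRank_eq_zero]
    exact zero_lt_one

/-- A set with the cofinite topology is Noetherian, and its sobrification rank is `0` if it
is empty, `1` if it is finite and nonempty, and `2` if it is infinite. -/
theorem sobRank_cofinite (X : Type u) :
    NoetherianSpace (CofiniteTopology X) ∧
    (IsEmpty X → sobRank (CofiniteTopology X) = 0) ∧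
    (Finite X → Nonempty X → sobRank (CofiniteTopology X) = 1) ∧
    (Infinite X → sobRank (CofiniteTopology X) = 2) := by
  refine ⟨inferInstance, fun _ => ?_, fun _ _ => ?_, fun _ => ?_⟩
  · have : IsEmpty (CofiniteTopology X) := CofiniteTopology.of.symm.isEmpty
    exact nonpos_iff_eq_zero.mp <|
      ordRank_le_of_forall_lt fun s => isEmptyElim s.isIrreducible.nonempty.some
  · have : Finite (CofiniteTopology X) := Finite.of_equiv X CofiniteTopology.of
    obtain ⟨x⟩ := ‹Nonempty X›
    refine le_antisymm (ordRank_le_of_forall_lt fun s => ?_) ?_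
    · rw [(IrreducibleCloseds.isMin_of_finite (Set.toFinite _)).wfRank_eq_zero]
      exact zero_lt_one
    · exact Order.one_le_iff_pos.mpr <| zero_le.trans_lt <|
        wfRank_lt_ordRank ({CofiniteTopology.of x} : IrreducibleCloseds (CofiniteTopology X))
  · have : Infinite (CofiniteTopology X) := Infinite.of_injective _ CofiniteTopology.of.injective
    rw [← one_add_one_eq_two]
    refine le_antisymm (ordRank_le_of_forall_lt fun s =>
      Order.lt_add_one_iff.mpr (wfRank_irreducibleCloseds_cofinite_le_one s)) ?_
    obtain ⟨x, y, hxy⟩ := exists_pair_ne (CofiniteTopology X)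
    let u : IrreducibleCloseds (CofiniteTopology X) :=
      ⟨Set.univ, IrreducibleSpace.isIrreducible_univ _, isClosed_univ⟩
    have hxu : {x} < u := lt_of_le_not_ge (fun _ _ => Set.mem_univ _)
      fun h => hxy (h (Set.mem_univ y) : y = x).symm
    exact Order.add_one_le_of_lt <|
      (Order.one_le_iff_pos.mpr <| zero_le.trans_lt (wfRank_lt_wfRank hxu)).trans_lt
        (wfRank_lt_ordRank u)
end

section
/- For every Noetherian space X, the lifted Hoare powerspace H₀X (the set of all closed subsets of X with the lower Vietoris topology) is a Noetherian space whose sobrification rank equals ||X|| + 1: sob(H₀X) = ||X|| + 1. -/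
open TopologicalSpace

/-- The lifted Hoare powerspace of a topological space: the set of all closed subsets,
equipped with the lower Vietoris topology generated by the sets
`◊U = {F closed | F ∩ U ≠ ∅}` for `U` open. -/
def HoareSpace (X : Type*) [TopologicalSpace X] : Type _ := Closeds X

instance HoareSpace.instTopologicalSpace (X : Type*) [TopologicalSpace X] :
    TopologicalSpace (HoareSpace X) :=
  TopologicalSpace.generateFrom
    { s : Set (Closeds X) | ∃ U : Set X, IsOpen U ∧
        s = { F : Closeds X | ((F : Set X) ∩ U).Nonempty } }

section Rank

variable {α β : Type*} [Preorder α] [Preorder β]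

theorem wfRank_eq_rank [h : WellFoundedLT α] (a : α) :
    wfRank a = IsWellFounded.rank (· < ·) a :=
  dif_pos h

theorem wfRank_mono [WellFoundedLT α] {a b : α} (h : a ≤ b) : wfRank a ≤ wfRank b := by
  rw [wfRank_eq_rank, wfRank_eq_rank, IsWellFounded.rank_eq, Ordinal.iSup_le_iff]
  rintro ⟨c, hc⟩
  exact Order.succ_le_of_lt (IsWellFounded.rank_lt_of_rel (hc.trans_le h))

theorem ordRank_eq_wfRank_top_add_one [OrderTop α] [WellFoundedLT α] :
    ordRank α = wfRank (⊤ : α) + 1 :=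
  le_antisymm
    (Ordinal.iSup_le fun _ => add_le_add_left (wfRank_mono le_top) 1)
    (Ordinal.le_iSup (fun a : α => wfRank a + 1) ⊤)

end Rank

theorem OrderIso.wfRank_apply {α β : Type u} [Preorder α] [Preorder β] [WellFoundedLT α]
    (e : α ≃o β) (a : α) : wfRank (e a) = wfRank a := by
  have : WellFoundedLT β := e.symm.toOrderEmbedding.wellFoundedLT
  induction a using WellFoundedLT.induction with
  | ind a ih =>
    simp only [wfRank_eq_rank] at ih ⊢
    rw [IsWellFounded.rank_eq, IsWellFounded.rank_eq]
    apply le_antisymm <;> rw [Ordinal.iSup_le_iff]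
    · rintro ⟨b, hb⟩
      have hb' : e.symm b < a := by simpa using e.symm.strictMono hb
      have hr := ih _ hb'
      rw [e.apply_symm_apply] at hr
      rw [hr]
      exact Ordinal.le_iSup
        (fun c : {c // c < a} => Order.succ (IsWellFounded.rank (· < ·) c.1)) ⟨_, hb'⟩
    · rintro ⟨b, hb⟩
      rw [← ih b hb]
      exact Ordinal.le_iSup
        (fun c : {c // c < e a} => Order.succ (IsWellFounded.rank (· < ·) c.1))
        ⟨_, e.strictMono hb⟩

theorem OrderIso.ordRank_eq {α β : Type u} [Preorder α] [Preorder β] [WellFoundedLT α]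
    (e : α ≃o β) : ordRank α = ordRank β :=
  e.toEquiv.iSup_congr fun a => congrArg (· + 1) (e.wfRank_apply a)

namespace Topology.IsUpper

variable {α : Type*} [CompleteLattice α] [TopologicalSpace α] [IsUpper α]

theorem noetherianSpace [WellFoundedLT α] : NoetherianSpace α := by
  refine noetherianSpace_iff_isCompact.2 fun s => isCompact_generateFrom (topology_eq α) ?_
  intro P hP hs
  obtain ⟨t, ht, htinf⟩ := CompleteLattice.WellFoundedGT.isSupFiniteCompact αᵒᵈ
    (OrderDual.ofDual ⁻¹' {a : α | (Set.Iic a)ᶜ ∈ P})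
  refine ⟨(fun a : αᵒᵈ => (Set.Iic (OrderDual.ofDual a))ᶜ) '' t, ?_, t.finite_toSet.image _, ?_⟩
  · rintro _ ⟨a, ha, rfl⟩
    exact ht ha
  · intro x hx
    by_contra hxt
    have hle : ∀ a ∈ t, x ≤ OrderDual.ofDual a := by simpa using hxt
    obtain ⟨U, hU, hxU⟩ := hs hx
    obtain ⟨a, rfl⟩ := hP hU
    refine hxU ?_
    have h₁ : OrderDual.toDual a ≤ t.sup id := htinf ▸ le_sSup hU
    exact h₁.trans (Finset.sup_le (a := OrderDual.toDual x) fun b hb => hle b hb)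

theorem sSup_mem_of_isIrreducible {K : Set α} (hK : IsIrreducible K) (hc : IsClosed K) :
    sSup K ∈ K := by
  classical
  by_contra hmem
  obtain ⟨_, ⟨t, ht, rfl⟩, hmt, htK⟩ :=
    (IsUpper.isTopologicalBasis (α := α)).exists_subset_of_mem_open hmem hc.isOpen_compl
  obtain ⟨_, hz, hKz⟩ := isIrreducible_iff_sUnion_isClosed.1 hK (ht.toFinset.image Set.Iic)
    (by simp only [Finset.mem_image]; rintro _ ⟨a, -, rfl⟩; exact isClosed_Iic)
    (fun x hx => by
      have : x ∈ (lowerClosure t : Set α) := by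
        by_contra h
        exact htK h hx
      simpa [mem_lowerClosure] using this)
  obtain ⟨a, ha, rfl⟩ := Finset.mem_image.1 hz
  exact hmt ⟨a, ht.mem_toFinset.1 ha, sSup_le hKz⟩

theorem eq_Iic_sSup_of_isIrreducible {K : Set α} (hK : IsIrreducible K) (hc : IsClosed K) :
    K = Set.Iic (sSup K) :=
  Set.Subset.antisymm (fun _ => le_sSup) fun _ hx =>
    isLowerSet_of_isClosed hc hx (sSup_mem_of_isIrreducible hK hc)

variable (α) in
/-- In the upper topology on a complete lattice, the irreducible closed sets are exactly the
principal lower sets. -/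
def orderIsoIrreducibleCloseds : α ≃o IrreducibleCloseds α where
  toFun a := ⟨Set.Iic a, closure_singleton a ▸ isIrreducible_singleton.closure, isClosed_Iic⟩
  invFun K := sSup (K : Set α)
  left_inv _ := isLUB_Iic.sSup_eq
  right_inv K := IrreducibleCloseds.ext
    (eq_Iic_sSup_of_isIrreducible K.isIrreducible K.isClosed).symm
  map_rel_iff' := Set.Iic_subset_Iic

end Topology.IsUpper

namespace HoareSpace

variable (X : Type*) [TopologicalSpace X]

instance : CompleteLattice (HoareSpace X) := inferInstanceAs (CompleteLattice (Closeds X))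

instance [NoetherianSpace X] : WellFoundedLT (HoareSpace X) :=
  inferInstanceAs (WellFoundedLT (Closeds X))

instance : Topology.IsUpper (HoareSpace X) where
  topology_eq_upperTopology := by
    refine congrArg generateFrom (Set.ext fun s => ⟨?_, ?_⟩)
    · rintro ⟨U, hU, rfl⟩
      refine ⟨(⟨Uᶜ, hU.isClosed_compl⟩ : Closeds X), Set.ext fun F : Closeds X => ?_⟩
      change ¬ ((F : Set X) ⊆ Uᶜ) ↔ ((F : Set X) ∩ U).Nonempty
      rw [← Set.disjoint_compl_right_iff_subset, compl_compl, Set.not_disjoint_iff_nonempty_inter]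
    · rintro ⟨C, rfl⟩
      change Closeds X at C
      refine ⟨(C : Set X)ᶜ, C.isClosed.isOpen_compl, Set.ext fun F : Closeds X => ?_⟩
      change ¬ ((F : Set X) ⊆ C) ↔ ((F : Set X) ∩ (C : Set X)ᶜ).Nonempty
      rw [Set.inter_compl_nonempty_iff]

end HoareSpace

/-- For every Noetherian space `X`, the lifted Hoare powerspace `H₀X` is Noetherian and its
sobrification rank equals `‖X‖ + 1`. -/
theorem sobRank_hoare (X : Type u) [TopologicalSpace X] [NoetherianSpace X] :
    NoetherianSpace (HoareSpace X) ∧ sobRank (HoareSpace X) = stature X + 1 := by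
  exact ⟨Topology.IsUpper.noetherianSpace,
    (Topology.IsUpper.orderIsoIrreducibleCloseds (HoareSpace X)).ordRank_eq.symm.trans
      ordRank_eq_wfRank_top_add_one⟩
end

section
/- Let X be a nonempty Noetherian space and let α := ||X||. Then the space X* of finite words over X, with the word topology, is Noetherian, and its sobrification rank is sob(X*) = ω^(α̂) + 1, where α̂ = α + 1 if α = ε + n for some critical ordinal ε and some natural number n, and α̂ = α otherwise. If X is empty, sob(X*) = 1. -/
open TopologicalSpace

/-- The space of finite words over a topological space `X`: the set of finite lists over `X`,
equipped with the word topology, generated by the sets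
`X*U₁X*⋯X*UₙX* = {w | w has a (scattered) subword whose letters lie in U₁, …, Uₙ in order}`
for `U₁, …, Uₙ` open in `X`. -/
def WordSpace (X : Type*) [TopologicalSpace X] : Type _ := List X

instance WordSpace.instTopologicalSpace (X : Type*) [TopologicalSpace X] :
    TopologicalSpace (WordSpace X) :=
  TopologicalSpace.generateFrom
    { s : Set (List X) | ∃ Us : List (Set X), (∀ U ∈ Us, IsOpen U) ∧
        s = { w : List X | ∃ l : List X, l.Sublist w ∧ List.Forall₂ (· ∈ ·) l Us } }

/-- A critical ordinal is one satisfying `ω ^ ε = ε`. -/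
def IsCritical (e : Ordinal) : Prop := Ordinal.omega0 ^ e = e

/-- `adjsw α` is `α + 1` if `α = ε + n` for some critical ordinal `ε` and natural number `n`,
and `α` otherwise. -/
noncomputable def adjsw (a : Ordinal) : Ordinal :=
  open Classical in
  if ∃ (e : Ordinal) (n : ℕ), IsCritical e ∧ a = e + n then a + 1 else a

section WordRank

open Ordinal

namespace Ordinal

/-- The natural (Hessenberg) sum of two ordinals, the least operation that is strictly monotone
in both arguments. -/
noncomputable def natAdd (a b : Ordinal.{u}) : Ordinal.{u} :=
  max (⨆ x : Set.Iio a, Order.succ (natAdd x.1 b)) (⨆ x : Set.Iio b, Order.succ (natAdd a x.1))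
termination_by (a, b)
decreasing_by all_goals first | exact Prod.Lex.left _ _ x.2 | exact Prod.Lex.right _ x.2

theorem lt_natAdd_iff {a b d : Ordinal.{u}} :
    d < natAdd a b ↔ (∃ x < a, d ≤ natAdd x b) ∨ ∃ y < b, d ≤ natAdd a y := by
  rw [natAdd, lt_max_iff, Ordinal.lt_iSup_iff, Ordinal.lt_iSup_iff]
  simp

theorem natAdd_le_iff {a b d : Ordinal.{u}} :
    natAdd a b ≤ d ↔ (∀ x < a, natAdd x b < d) ∧ ∀ y < b, natAdd a y < d := by
  rw [← not_lt, lt_natAdd_iff]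
  push Not
  rfl

theorem natAdd_lt_natAdd_right {a a' : Ordinal.{u}} (h : a < a') (b : Ordinal.{u}) :
    natAdd a b < natAdd a' b :=
  lt_natAdd_iff.2 (Or.inl ⟨a, h, le_rfl⟩)

theorem natAdd_lt_natAdd_left {b b' : Ordinal.{u}} (h : b < b') (a : Ordinal.{u}) :
    natAdd a b < natAdd a b' :=
  lt_natAdd_iff.2 (Or.inr ⟨b, h, le_rfl⟩)

theorem natAdd_le_natAdd {a a' b b' : Ordinal.{u}} (h : a ≤ a') (h' : b ≤ b') :
    natAdd a b ≤ natAdd a' b' :=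
  ((StrictMono.monotone fun _ _ h ↦ natAdd_lt_natAdd_right h b) h).trans
    ((StrictMono.monotone fun _ _ h ↦ natAdd_lt_natAdd_left h a') h')

theorem natAdd_comm_le (a b : Ordinal.{u}) : natAdd a b ≤ natAdd b a := by
  rw [natAdd_le_iff]
  exact ⟨fun x hx ↦ (natAdd_comm_le x b).trans_lt (natAdd_lt_natAdd_left hx b),
    fun y hy ↦ (natAdd_comm_le a y).trans_lt (natAdd_lt_natAdd_right hy a)⟩
termination_by (a, b)

theorem natAdd_comm (a b : Ordinal.{u}) : natAdd a b = natAdd b a :=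
  (natAdd_comm_le a b).antisymm (natAdd_comm_le b a)

theorem natAdd_assoc_le (a b c : Ordinal.{u}) :
    natAdd (natAdd a b) c ≤ natAdd a (natAdd b c) := by
  rw [natAdd_le_iff]
  refine ⟨fun x hx ↦ ?_, fun y hy ↦ ?_⟩
  · obtain ⟨a', ha, h⟩ | ⟨b', hb, h⟩ := lt_natAdd_iff.1 hx
    · exact (natAdd_le_natAdd h le_rfl).trans_lt
        ((natAdd_assoc_le a' b c).trans_lt (natAdd_lt_natAdd_right ha _))
    · exact (natAdd_le_natAdd h le_rfl).trans_lt
        ((natAdd_assoc_le a b' c).trans_lt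
          (natAdd_lt_natAdd_left (natAdd_lt_natAdd_right hb _) _))
  · exact (natAdd_assoc_le a b y).trans_lt (natAdd_lt_natAdd_left (natAdd_lt_natAdd_left hy _) _)
termination_by (a, b, c)

theorem natAdd_assoc (a b c : Ordinal.{u}) :
    natAdd (natAdd a b) c = natAdd a (natAdd b c) := by
  refine (natAdd_assoc_le a b c).antisymm ?_
  rw [natAdd_comm a, natAdd_comm b, natAdd_comm _ c, natAdd_comm a]
  exact natAdd_assoc_le c b a

theorem natAdd_zero (a : Ordinal.{u}) : natAdd a 0 = a := by
  refine le_antisymm (natAdd_le_iff.2 ⟨fun x hx ↦ ?_, fun y hy ↦ ?_⟩)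
    (StrictMono.le_apply (f := fun a ↦ natAdd a 0) fun _ _ h ↦ natAdd_lt_natAdd_right h 0)
  · rwa [natAdd_zero x]
  · exact absurd hy not_lt_zero
termination_by a

theorem zero_natAdd (a : Ordinal.{u}) : natAdd 0 a = a := by
  rw [natAdd_comm, natAdd_zero]

theorem natAdd_le_mul_add {p : Ordinal.{u}} (hp : ∀ x < p, ∀ y < p, natAdd x y < p)
    (i j : ℕ) (x y : Ordinal.{u}) (hx : x < p) (hy : y < p) :
    natAdd (p * i + x) (p * j + y) ≤ p * (i + j : ℕ) + natAdd x y := by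
  have key : ∀ (i : ℕ) (x a : Ordinal.{u}), x < p → a < p * i + x →
      ∃ (i' : ℕ) (x' : Ordinal.{u}), a = p * i' + x' ∧ x' < p ∧ (i' < i ∨ i' = i ∧ x' < x) := by
    intro i x a hx ha
    have hp0 : p ≠ 0 := (bot_le.trans_lt hx).ne'
    have h1 : a / p < (i + 1 : ℕ) := by
      rw [← lt_mul_iff_div_lt hp0]
      refine ha.trans ?_
      push_cast
      rw [mul_add, mul_one]
      gcongr
    obtain ⟨k, hk⟩ := lt_omega0.1 (h1.trans (natCast_lt_omega0 _))
    have h2 := div_add_mod a p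
    rw [hk] at h1 h2
    have h1 : k < i + 1 := by exact_mod_cast h1
    refine ⟨k, a % p, h2.symm, mod_lt a hp0, ?_⟩
    obtain h | rfl := (Nat.lt_succ_iff.1 h1).lt_or_eq
    · exact Or.inl h
    · refine Or.inr ⟨rfl, ?_⟩
      rw [← h2] at ha
      simpa using ha
  have step : ∀ (n m : ℕ) (z w : Ordinal.{u}), z < p → n < m → p * n + z < p * m + w := by
    intro n m z w hz h
    calc p * n + z < p * n + p := by gcongr
      _ = p * (n + 1 : ℕ) := by push_cast; rw [mul_add, mul_one]
      _ ≤ p * m := by gcongr; exact_mod_cast h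
      _ ≤ _ := le_self_add
  rw [natAdd_le_iff]
  constructor
  · intro a ha
    obtain ⟨i', x', rfl, hx', h⟩ := key i x a hx ha
    refine (natAdd_le_mul_add hp i' j x' y hx' hy).trans_lt ?_
    obtain h | ⟨rfl, h⟩ := h
    · exact step _ _ _ _ (hp _ hx' _ hy) (by omega)
    · gcongr
      exact natAdd_lt_natAdd_right h _
  · intro b hb
    obtain ⟨j', y', rfl, hy', h⟩ := key j y b hy hb
    refine (natAdd_le_mul_add hp i j' x y' hx hy').trans_lt ?_
    obtain h | ⟨rfl, h⟩ := h
    · exact step _ _ _ _ (hp _ hx _ hy') (by omega)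
    · gcongr
      exact natAdd_lt_natAdd_left h _
termination_by (p * i + x, p * j + y)
decreasing_by
  · subst_vars; exact Prod.Lex.left _ _ ha
  · subst_vars; exact Prod.Lex.right _ hb

theorem natAdd_lt_omega0_opow (c : Ordinal.{u}) :
    ∀ a < ω ^ c, ∀ b < ω ^ c, natAdd a b < ω ^ c := by
  induction c using WellFoundedLT.induction with | _ c ih => ?_
  intro a ha b hb
  by_cases hc : c = 0
  · subst hc
    simp only [opow_zero, Order.lt_one_iff] at ha hb ⊢
    rw [ha, hb, natAdd_zero]
  set d := max (log ω a) (log ω b) with hd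
  have hdc : d < c := max_lt ((lt_opow_iff_log_lt' one_lt_omega0 hc).1 ha)
    ((lt_opow_iff_log_lt' one_lt_omega0 hc).1 hb)
  have aux : ∀ e : Ordinal.{u}, log ω e ≤ d → ∃ n : ℕ, e < ω ^ d * n := by
    intro e he
    have : e < ω ^ d * ω := by
      rw [← opow_add_one]
      exact lt_opow_of_log_lt one_lt_omega0 (he.trans_lt (lt_add_one d))
    obtain ⟨k, hk, h⟩ := (lt_mul_iff_of_isSuccLimit isSuccLimit_omega0).1 this
    obtain ⟨n, rfl⟩ := lt_omega0.1 hk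
    exact ⟨n, h⟩
  obtain ⟨n, hn⟩ := aux a (le_max_left _ _)
  obtain ⟨m, hm⟩ := aux b (le_max_right _ _)
  have h0 : (0 : Ordinal.{u}) < ω ^ d := opow_pos _ omega0_pos
  have := natAdd_le_mul_add (ih d hdc) n m 0 0 h0 h0
  simp only [add_zero] at this
  refine (natAdd_le_natAdd hn.le hm.le).trans_lt (this.trans_lt ?_)
  rw [natAdd_zero, add_zero]
  exact opow_mul_lt_opow (natCast_lt_omega0 _) hdc

/-- The natural sum of a list of ordinals. -/
noncomputable def natSum (L : List Ordinal.{u}) : Ordinal.{u} := L.foldr natAdd 0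

@[simp]
theorem natSum_nil : natSum [] = (0 : Ordinal.{u}) := rfl

@[simp]
theorem natSum_cons (a : Ordinal.{u}) (L : List Ordinal.{u}) :
    natSum (a :: L) = natAdd a (natSum L) := rfl

theorem natSum_append (L M : List Ordinal.{u}) :
    natSum (L ++ M) = natAdd (natSum L) (natSum M) := by
  induction L with
  | nil => simp [zero_natAdd]
  | cons a L ih => simp [ih, natAdd_assoc]

theorem natSum_lt_omega0_opow {c : Ordinal.{u}} {L : List Ordinal.{u}} (h : ∀ a ∈ L, a < ω ^ c) :
    natSum L < ω ^ c := by
  induction L with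
  | nil => exact opow_pos _ omega0_pos
  | cons a L ih =>
    simp only [List.mem_cons, forall_eq_or_imp] at h
    exact natAdd_lt_omega0_opow c _ h.1 _ (ih h.2)

end Ordinal

section Rank

variable {α : Type u} [PartialOrder α] [WellFoundedLT α]

theorem wfRank_eq (a : α) : wfRank a = IsWellFounded.rank (α := α) (· < ·) a :=
  dif_pos ‹_›

theorem wfRank_strictMono : StrictMono (wfRank : α → Ordinal.{u}) := fun a b h ↦ by
  rw [wfRank_eq, wfRank_eq]
  exact IsWellFounded.rank_lt_of_rel h

theorem wfRank_mono_s8 : Monotone (wfRank : α → Ordinal.{u}) :=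
  wfRank_strictMono.monotone

theorem lt_wfRank_iff {a : α} {o : Ordinal.{u}} : o < wfRank a ↔ ∃ b < a, o ≤ wfRank b := by
  simp only [wfRank_eq]
  rw [IsWellFounded.rank_eq, Ordinal.lt_iSup_iff]
  simp

theorem wfRank_le_of_forall_lt_s8 {f : α → Ordinal.{u}} (hf : ∀ a b, a < b → f a < f b) (a : α) :
    wfRank a ≤ f a := by
  induction a using WellFoundedLT.induction with | _ a ih => ?_
  by_contra! h
  obtain ⟨b, hb, hab⟩ := lt_wfRank_iff.1 h
  exact (hab.trans (ih b hb)).not_gt (hf b a hb)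

theorem wfRank_add_le {β : Type u} [PartialOrder β] [WellFoundedLT β] {q : β} {g : α → β} {a : α}
    (hg : ∀ x y, x < y → y ≤ a → g x < g y) (hq : ∀ x ≤ a, q ≤ g x) :
    wfRank q + wfRank a ≤ wfRank (g a) := by
  suffices ∀ x ≤ a, wfRank q + wfRank x ≤ wfRank (g x) from this a le_rfl
  intro x
  induction x using WellFoundedLT.induction with | _ x ih => ?_
  intro hx
  obtain h0 | h0 := eq_or_ne (wfRank x) 0
  · rw [h0, add_zero]
    exact wfRank_mono_s8 (hq x hx)
  rw [Ordinal.add_le_iff h0]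
  intro o ho
  obtain ⟨y, hy, hoy⟩ := lt_wfRank_iff.1 ho
  have hya : y ≤ a := hy.le.trans hx
  calc wfRank q + o ≤ wfRank q + wfRank y := by gcongr
    _ ≤ wfRank (g y) := ih y hy hya
    _ < wfRank (g x) := wfRank_strictMono (hg y x hy hx)

theorem ordRank_of_top [OrderTop α] : ordRank α = wfRank (⊤ : α) + 1 := by
  refine le_antisymm (Ordinal.iSup_le fun a ↦ ?_) (Ordinal.le_iSup (fun a : α ↦ wfRank a + 1) ⊤)
  gcongr
  exact wfRank_mono_s8 le_top

end Rank

section Adjsw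

theorem adjsw_of_exists {a : Ordinal.{u}} (h : ∃ (e : Ordinal) (n : ℕ), IsCritical e ∧ a = e + n) :
    adjsw a = a + 1 :=
  if_pos h

theorem adjsw_of_not_exists {a : Ordinal.{u}}
    (h : ¬ ∃ (e : Ordinal) (n : ℕ), IsCritical e ∧ a = e + n) : adjsw a = a :=
  if_neg h

theorem le_adjsw (a : Ordinal.{u}) : a ≤ adjsw a := by
  unfold adjsw
  split_ifs <;> simp

theorem adjsw_add_one (a : Ordinal.{u}) (h : ¬ IsCritical (a + 1)) :
    adjsw (a + 1) = adjsw a + 1 := by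
  by_cases ha : ∃ (e : Ordinal) (n : ℕ), IsCritical e ∧ a = e + n
  · rw [adjsw_of_exists ha, adjsw_of_exists]
    obtain ⟨e, n, he, rfl⟩ := ha
    exact ⟨e, n + 1, he, by push_cast; rw [add_assoc]⟩
  · rw [adjsw_of_not_exists ha, adjsw_of_not_exists]
    rintro ⟨e, n, he, hn⟩
    cases n with
    | zero => exact h (by simpa [hn] using he)
    | succ n =>
      push_cast at hn
      rw [← add_assoc] at hn
      exact ha ⟨e, n, he, Order.succ_injective (by simpa using hn)⟩

theorem adjsw_strictMono : StrictMono (adjsw : Ordinal.{u} → Ordinal.{u}) := fun a b h ↦ by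
  by_cases ha : ∃ (e : Ordinal) (n : ℕ), IsCritical e ∧ a = e + n
  · obtain h | h := (Order.add_one_le_of_lt h).eq_or_lt
    · have : adjsw b = b + 1 := by
        obtain ⟨e, n, he, rfl⟩ := ha
        exact adjsw_of_exists ⟨e, n + 1, he, by rw [← h]; push_cast; rw [add_assoc]⟩
      rw [adjsw_of_exists ha, this, h]
      exact lt_add_one b
    · rw [adjsw_of_exists ha]
      exact h.trans_le (le_adjsw b)
  · rw [adjsw_of_not_exists ha]
    exact h.trans_le (le_adjsw b)

theorem lt_omega0_opow_adjsw (a : Ordinal.{u}) : a < ω ^ adjsw a := by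
  by_cases ha : IsCritical a
  · rw [adjsw_of_exists ⟨a, 0, ha, by simp⟩]
    refine (right_le_opow a one_lt_omega0).trans_lt ?_
    exact (opow_lt_opow_iff_right one_lt_omega0).2 (lt_add_one a)
  · refine ((right_le_opow a one_lt_omega0).lt_of_ne fun h ↦ ha h.symm).trans_le ?_
    exact opow_le_opow_right omega0_pos (le_adjsw a)

theorem adjsw_of_isSuccLimit {a : Ordinal.{u}} (h : Order.IsSuccLimit a) (ha : ¬ IsCritical a) :
    adjsw a = a := by
  refine adjsw_of_not_exists ?_
  rintro ⟨e, n, he, rfl⟩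
  cases n with
  | zero => exact ha (by simpa using he)
  | succ n =>
    push_cast at h
    rw [← add_assoc] at h
    exact Order.not_isSuccLimit_add_one _ h

theorem adjsw_zero : adjsw (0 : Ordinal.{u}) = 0 := by
  refine adjsw_of_not_exists ?_
  rintro ⟨e, n, he, h⟩
  obtain ⟨rfl, -⟩ := Ordinal.add_eq_zero_iff.1 h.symm
  simp [IsCritical] at he

end Adjsw

section Union

variable {Y : Type u} [TopologicalSpace Y]

theorem TopologicalSpace.IrreducibleCloseds.exists_le_of_forall_mem {C : IrreducibleCloseds Y}
    {L : List (IrreducibleCloseds Y)} (h : ∀ y ∈ C, ∃ D ∈ L, y ∈ D) : ∃ D ∈ L, C ≤ D := by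
  classical
  have := isIrreducible_iff_sUnion_isClosed.1 C.isIrreducible
    (L.toFinset.image fun D : IrreducibleCloseds Y ↦ (D : Set Y)) (by
      simp only [Finset.mem_image]
      rintro _ ⟨D, -, rfl⟩
      exact D.isClosed)
    (fun y hy ↦ by
      obtain ⟨D, hD, hy⟩ := h y hy
      exact ⟨D, Finset.mem_image_of_mem _ (List.mem_toFinset.2 hD), hy⟩)
  obtain ⟨z, hz, hC⟩ := this
  simp only [Finset.mem_image, List.mem_toFinset] at hz
  obtain ⟨D, hD, rfl⟩ := hz
  exact ⟨D, hD, hC⟩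

variable {K : Set (IrreducibleCloseds Y)} {ν : IrreducibleCloseds Y → Ordinal.{u}}

theorem exists_union_eq_natSum_lt (hν : ∀ C ∈ K, ∀ D ∈ K, C < D → ν C < ν D)
    (T : List (IrreducibleCloseds Y)) :
    ∀ S : List (IrreducibleCloseds Y), (∀ C ∈ S, C ∈ K) → (∀ C ∈ T, C ∈ K) →
    (∀ C ∈ S, ∃ D ∈ T, C ≤ D) → ∃ S' : List (IrreducibleCloseds Y), (∀ C ∈ S', C ∈ K) ∧
      (∀ y, (∃ C ∈ S', y ∈ C) ↔ ∃ C ∈ S, y ∈ C) ∧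
      (S' = T ∨ natSum (S'.map (ω ^ ν ·)) < natSum (T.map (ω ^ ν ·))) := by
  classical
  induction T with
  | nil =>
    intro S _ _ h
    have : S = [] := List.eq_nil_iff_forall_not_mem.2 fun C hC ↦ by simpa using h C hC
    exact ⟨[], by simp [this]⟩
  | cons t T ih =>
    intro S hS hT h
    obtain ⟨S₂, hS₂K, hS₂, hlt⟩ := ih (S.filter (¬ · ≤ t)) (fun C hC ↦ hS C (List.mem_of_mem_filter hC))
      (fun C hC ↦ hT C (List.mem_cons_of_mem _ hC)) (fun C hC ↦ by
        simp only [List.mem_filter, decide_eq_true_eq] at hC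
        obtain ⟨D, hD, hCD⟩ := h C hC.1
        obtain rfl | hD := List.mem_cons.1 hD
        · exact absurd hCD hC.2
        · exact ⟨D, hD, hCD⟩)
    obtain ⟨S₁, hS₁K, hS₁, h1⟩ : ∃ S₁ : List (IrreducibleCloseds Y), (∀ C ∈ S₁, C ∈ K) ∧
        (∀ y, (∃ C ∈ S₁, y ∈ C) ↔ ∃ C ∈ S, C ≤ t ∧ y ∈ C) ∧
        (S₁ = [t] ∨ natSum (S₁.map (ω ^ ν ·)) < ω ^ ν t) := by
      by_cases ht : t ∈ S
      · refine ⟨[t], by simpa using hS t ht, fun y ↦ ⟨?_, ?_⟩, Or.inl rfl⟩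
        · rintro ⟨C, hC, hy⟩
          obtain rfl := List.mem_singleton.1 hC
          exact ⟨C, ht, le_rfl, hy⟩
        · rintro ⟨C, hC, hCt, hy⟩
          exact ⟨t, by simp, hCt hy⟩
      · refine ⟨S.filter (· ≤ t), fun C hC ↦ hS C (List.mem_of_mem_filter hC), by simp [and_assoc],
          Or.inr (natSum_lt_omega0_opow ?_)⟩
        simp only [List.mem_map, List.mem_filter, decide_eq_true_eq]
        rintro _ ⟨C, ⟨hC, hCt⟩, rfl⟩
        refine (opow_lt_opow_iff_right one_lt_omega0).2 (hν C (hS C hC) t (hT t (by simp)) ?_)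
        exact hCt.lt_of_ne fun h ↦ ht (h ▸ hC)
    refine ⟨S₁ ++ S₂, by grind, fun y ↦ ?_, ?_⟩
    · have e1 := hS₁ y
      have e2 := hS₂ y
      simp only [List.mem_filter, decide_eq_true_eq, List.mem_append, or_and_right, exists_or] at e1 e2 ⊢
      rw [e1, e2]
      constructor
      · rintro (⟨C, hC, _, hy⟩ | ⟨C, ⟨hC, _⟩, hy⟩) <;> exact ⟨C, hC, hy⟩
      · rintro ⟨C, hC, hy⟩
        by_cases hCt : C ≤ t
        · exact Or.inl ⟨C, hC, hCt, hy⟩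
        · exact Or.inr ⟨C, ⟨hC, hCt⟩, hy⟩
    · rw [List.map_append, natSum_append, List.map_cons, natSum_cons]
      obtain rfl | h1 := h1
      · obtain rfl | h2 := hlt
        · exact Or.inl rfl
        · right
          simpa [natAdd_zero] using natAdd_lt_natAdd_left h2 _
      · right
        refine (natAdd_lt_natAdd_right h1 _).trans_le (natAdd_le_natAdd le_rfl ?_)
        obtain rfl | h2 := hlt
        · exact le_rfl
        · exact h2.le

/-- The least natural sum of the `ω ^ ν C` over all finite families `C` in `K` with union `F`. -/
noncomputable def unionRank (K : Set (IrreducibleCloseds Y)) (ν : IrreducibleCloseds Y → Ordinal.{u})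
    (F : Set Y) : Ordinal.{u} :=
  sInf {o | ∃ S : List (IrreducibleCloseds Y), (∀ C ∈ S, C ∈ K) ∧
    (∀ y, y ∈ F ↔ ∃ C ∈ S, y ∈ C) ∧ o = natSum (S.map (ω ^ ν ·))}

theorem unionRank_le {F : Set Y} {S : List (IrreducibleCloseds Y)} (hS : ∀ C ∈ S, C ∈ K)
    (hF : ∀ y, y ∈ F ↔ ∃ C ∈ S, y ∈ C) : unionRank K ν F ≤ natSum (S.map (ω ^ ν ·)) :=
  csInf_le' ⟨S, hS, hF, rfl⟩

theorem unionRank_lt (hν : ∀ C ∈ K, ∀ D ∈ K, C < D → ν C < ν D) {F G : Set Y} (h : F ⊂ G)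
    (hF : ∃ S : List (IrreducibleCloseds Y), (∀ C ∈ S, C ∈ K) ∧ ∀ y, y ∈ F ↔ ∃ C ∈ S, y ∈ C)
    (hG : ∃ S : List (IrreducibleCloseds Y), (∀ C ∈ S, C ∈ K) ∧ ∀ y, y ∈ G ↔ ∃ C ∈ S, y ∈ C) :
    unionRank K ν F < unionRank K ν G := by
  obtain ⟨S, hS, hF⟩ := hF
  have : unionRank K ν G ∈ _ := csInf_mem (s := {o | ∃ S : List (IrreducibleCloseds Y),
      (∀ C ∈ S, C ∈ K) ∧ (∀ y, y ∈ G ↔ ∃ C ∈ S, y ∈ C) ∧ o = natSum (S.map (ω ^ ν ·))})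
    (by obtain ⟨T, hT, hG⟩ := hG; exact ⟨_, T, hT, hG, rfl⟩)
  obtain ⟨T, hT, hG, e⟩ := this
  rw [e]
  obtain ⟨S', hS'K, hS', h'⟩ := exists_union_eq_natSum_lt hν T S hS hT fun C hC ↦
    IrreducibleCloseds.exists_le_of_forall_mem fun y hy ↦ (hG y).1 (h.1 ((hF y).2 ⟨C, hC, hy⟩))
  have hFS' : ∀ y, y ∈ F ↔ ∃ C ∈ S', y ∈ C := fun y ↦ (hF y).trans (hS' y).symm
  obtain rfl | h' := h'
  · exact absurd (fun y hy ↦ (hFS' y).2 ((hG y).1 hy)) h.2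
  · exact (unionRank_le hS'K hFS').trans_lt h'

theorem wellFoundedLT_closeds_of_forall_union (hν : ∀ C ∈ K, ∀ D ∈ K, C < D → ν C < ν D)
    (hK : ∀ F : Closeds Y, ∃ S : List (IrreducibleCloseds Y), (∀ C ∈ S, C ∈ K) ∧
      ∀ y, y ∈ F ↔ ∃ C ∈ S, y ∈ C) : WellFoundedLT (Closeds Y) :=
  StrictMono.wellFoundedLT (f := fun F : Closeds Y ↦ unionRank K ν F)
    fun F G h ↦ unionRank_lt hν h (hK F) (hK G)

end Union

section Noetherian

variable {X : Type u} [TopologicalSpace X] [NoetherianSpace X]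

instance : WellFoundedLT (IrreducibleCloseds X) :=
  StrictMono.wellFoundedLT (β := Closeds X) (f := fun C ↦ ⟨C, C.isClosed⟩) fun _ _ h ↦ h

theorem TopologicalSpace.Closeds.exists_list_irreducibleCloseds (F : Closeds X) :
    ∃ S : List (IrreducibleCloseds X), ∀ y, y ∈ F ↔ ∃ C ∈ S, y ∈ C := by
  obtain ⟨S, hS, hc, hi, hF⟩ :=
    NoetherianSpace.exists_finite_set_isClosed_irreducible F.isClosed
  have hfin : {C : IrreducibleCloseds X | (C : Set X) ∈ S}.Finite :=
    hS.preimage fun _ _ _ _ h ↦ SetLike.coe_injective h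
  refine ⟨hfin.toFinset.toList, fun y ↦ ?_⟩
  rw [← SetLike.mem_coe, hF, Set.mem_sUnion]
  simp only [Finset.mem_toList, Set.Finite.mem_toFinset, Set.mem_ofPred_eq]
  exact ⟨fun ⟨t, ht, hy⟩ ↦ ⟨⟨t, hi t ht, hc t ht⟩, ht, hy⟩, fun ⟨C, hC, hy⟩ ↦ ⟨C, hC, hy⟩⟩

theorem exists_irreducibleCloseds_le_wfRank {F : Closeds X} (h : IsCritical (wfRank F)) :
    ∃ C : IrreducibleCloseds X, (C : Set X) ⊆ F ∧ wfRank F ≤ wfRank C := by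
  by_contra! hlt
  obtain ⟨S, hS⟩ := Closeds.exists_list_irreducibleCloseds F
  have h1 : wfRank F ≤ unionRank Set.univ wfRank (F : Set X) := by
    refine wfRank_le_of_forall_lt_s8 (f := fun F : Closeds X ↦ unionRank Set.univ wfRank (F : Set X))
      (fun F G h ↦ unionRank_lt (fun C _ D _ h ↦ wfRank_strictMono h) h ?_ ?_) F
    · simpa using F.exists_list_irreducibleCloseds
    · simpa using G.exists_list_irreducibleCloseds
  refine (h1.trans (unionRank_le (S := S) (by simp) hS)).not_gt ?_
  refine (natSum_lt_omega0_opow fun a ha ↦ ?_).trans_eq h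
  obtain ⟨C, hC, rfl⟩ := List.mem_map.1 ha
  exact (opow_lt_opow_iff_right one_lt_omega0).2 (hlt C fun y hy ↦ (hS y).2 ⟨C, hC, hy⟩)

end Noetherian

namespace WordSpace

section Basic

variable {X : Type u}

/-- The subbasic set of words having a subword with letters in the members of `Us`, in order. -/
def occ (Us : List (Set X)) : Set (List X) :=
  {w | ∃ l : List X, l.Sublist w ∧ List.Forall₂ (· ∈ ·) l Us}

@[simp]
theorem mem_occ_nil (w : List X) : w ∈ occ ([] : List (Set X)) :=
  ⟨[], List.nil_sublist w, List.Forall₂.nil⟩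

@[simp]
theorem nil_notMem_occ_cons (U : Set X) (Us : List (Set X)) : [] ∉ occ (U :: Us) := by
  rintro ⟨l, hl, h⟩
  obtain rfl := List.sublist_nil.1 hl
  cases h

theorem mem_occ_of_sublist {Us : List (Set X)} {v w : List X} (h : v.Sublist w) (hv : v ∈ occ Us) :
    w ∈ occ Us := by
  obtain ⟨l, hl, h'⟩ := hv
  exact ⟨l, hl.trans h, h'⟩

theorem cons_mem_occ_cons {U : Set X} {Us : List (Set X)} {a : X} {w : List X} :
    a :: w ∈ occ (U :: Us) ↔ w ∈ occ (U :: Us) ∨ a ∈ U ∧ w ∈ occ Us := by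
  constructor
  · rintro ⟨l, hl, h⟩
    cases hl with
    | cons _ hl => exact Or.inl ⟨l, hl, h⟩
    | cons_cons _ hl =>
      cases h with
      | cons h1 h2 => exact Or.inr ⟨h1, _, hl, h2⟩
  · rintro (h | ⟨h, l, hl, h'⟩)
    · exact mem_occ_of_sublist (List.sublist_cons_self _ _) h
    · exact ⟨a :: l, hl.cons_cons a, h'.cons h⟩

theorem mem_occ_cons {U : Set X} {Us : List (Set X)} {w : List X} :
    w ∈ occ (U :: Us) ↔ ∃ x a y, w = x ++ a :: y ∧ a ∈ U ∧ y ∈ occ Us := by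
  constructor
  · induction w with
    | nil => simp
    | cons b w ih =>
      rw [cons_mem_occ_cons]
      rintro (h | ⟨h, h'⟩)
      · obtain ⟨x, a, y, rfl, h2⟩ := ih h
        exact ⟨b :: x, a, y, rfl, h2⟩
      · exact ⟨[], b, w, rfl, h, h'⟩
  · rintro ⟨x, a, y, rfl, ha, hy⟩
    exact mem_occ_of_sublist (List.sublist_append_right _ _) (cons_mem_occ_cons.2 (Or.inr ⟨ha, hy⟩))

variable [TopologicalSpace X]

theorem isOpen_occ {Us : List (Set X)} (h : ∀ U ∈ Us, IsOpen U) :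
    IsOpen (X := WordSpace X) (occ Us) :=
  isOpen_generateFrom_of_mem ⟨Us, h, rfl⟩

theorem mem_of_isOpen_of_sublist {O : Set (List X)} (hO : IsOpen (X := WordSpace X) O)
    {v w : List X} (h : v.Sublist w) (hv : v ∈ O) : w ∈ O := by
  induction hO with
  | basic s hs =>
    obtain ⟨Us, -, rfl⟩ := hs
    exact mem_occ_of_sublist h hv
  | univ => trivial
  | inter s t _ _ hs ht => exact ⟨hs hv.1, ht hv.2⟩
  | sUnion S _ ih =>
    obtain ⟨s, hs, hv⟩ := hv
    exact ⟨s, hs, ih s hs hv⟩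

theorem continuous_cons_right (a : X) :
    Continuous (X := WordSpace X) (Y := WordSpace X) (fun w : List X ↦ (a :: w : List X)) := by
  refine continuous_generateFrom_iff.2 ?_
  rintro _ ⟨Us, hUs, rfl⟩
  change IsOpen (X := WordSpace X) {w : List X | a :: w ∈ occ Us}
  cases Us with
  | nil =>
    have h : {w : WordSpace X | a :: w ∈ occ ([] : List (Set X))} = Set.univ :=
      Set.eq_univ_of_forall fun w ↦ mem_occ_nil (a :: w)
    exact h ▸ isOpen_univ (X := WordSpace X)
  | cons U Us =>
    by_cases ha : a ∈ U
    · simp only [cons_mem_occ_cons, ha, true_and]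
      exact (isOpen_occ hUs).union (isOpen_occ fun V hV ↦ hUs V (List.mem_cons_of_mem _ hV))
    · simp only [cons_mem_occ_cons, ha, false_and, or_false]
      exact isOpen_occ hUs

theorem continuous_cons_left (w : List X) :
    Continuous (Y := WordSpace X) (fun a : X ↦ (a :: w : List X)) := by
  refine continuous_generateFrom_iff.2 ?_
  rintro _ ⟨Us, hUs, rfl⟩
  change IsOpen {a : X | a :: w ∈ occ Us}
  cases Us with
  | nil => simp
  | cons U Us =>
    by_cases h1 : w ∈ occ (U :: Us)
    · simp [cons_mem_occ_cons, h1]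
    · by_cases h2 : w ∈ occ Us
      · simpa [cons_mem_occ_cons, h1, h2] using hUs U (by simp)
      · simp [cons_mem_occ_cons, h1, h2]

theorem continuous_append_right (u : List X) :
    Continuous (X := WordSpace X) (Y := WordSpace X) (fun w : List X ↦ (u ++ w : List X)) := by
  induction u with
  | nil => exact continuous_id
  | cons a u ih => exact (continuous_cons_right a).comp ih

end Basic

/-- The atoms of word products: `A*` for a nonempty closed set `A`, and `C ∪ {ε}` for an
irreducible closed set `C`. -/
inductive Atom (X : Type u) [TopologicalSpace X] : Type u
  | star (A : Closeds X) (h : (A : Set X).Nonempty) : Atom X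
  | opt (C : IrreducibleCloseds X) : Atom X

section Prod

variable {X : Type u} [TopologicalSpace X]

/-- The set of words denoted by an atom. -/
def Atom.toSet : Atom X → Set (List X)
  | .star A _ => {w | ∀ a ∈ w, a ∈ A}
  | .opt C => {w | w = [] ∨ ∃ c ∈ C, w = [c]}

/-- The word product denoted by a list of atoms. -/
def prod : List (Atom X) → Set (List X)
  | [] => {[]}
  | e :: p => {w | ∃ u v, w = u ++ v ∧ u ∈ e.toSet ∧ v ∈ prod p}

theorem mem_prod_nil {w : List X} : w ∈ prod ([] : List (Atom X)) ↔ w = [] := Iff.rfl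

theorem mem_prod_cons {e : Atom X} {p : List (Atom X)} {w : List X} :
    w ∈ prod (e :: p) ↔ ∃ u v, w = u ++ v ∧ u ∈ e.toSet ∧ v ∈ prod p := Iff.rfl

theorem mem_prod_append {p q : List (Atom X)} {w : List X} :
    w ∈ prod (p ++ q) ↔ ∃ u v, w = u ++ v ∧ u ∈ prod p ∧ v ∈ prod q := by
  induction p generalizing w with
  | nil => simp [mem_prod_nil]
  | cons e p ih =>
    simp only [List.cons_append, mem_prod_cons, ih]
    constructor
    · rintro ⟨u, _, rfl, hu, v, w, rfl, hv, hw⟩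
      exact ⟨u ++ v, w, by simp, ⟨u, v, rfl, hu, hv⟩, hw⟩
    · rintro ⟨_, w, rfl, ⟨u, v, rfl, hu, hv⟩, hw⟩
      exact ⟨u, v ++ w, by simp, hu, v, w, rfl, hv, hw⟩

theorem mem_prod_opt {C : IrreducibleCloseds X} {p : List (Atom X)} {w : List X} :
    w ∈ prod (.opt C :: p) ↔ w ∈ prod p ∨ ∃ c ∈ C, ∃ v ∈ prod p, w = c :: v := by
  constructor
  · rintro ⟨u, v, rfl, rfl | ⟨c, hc, rfl⟩, hv⟩
    · exact Or.inl hv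
    · exact Or.inr ⟨c, hc, v, hv, rfl⟩
  · rintro (h | ⟨c, hc, v, hv, rfl⟩)
    · exact ⟨[], w, rfl, Or.inl rfl, h⟩
    · exact ⟨[c], v, rfl, Or.inr ⟨c, hc, rfl⟩, hv⟩

theorem cons_mem_prod_star {A : Closeds X} {hA} {p : List (Atom X)} {a : X} {w : List X} :
    a :: w ∈ prod (.star A hA :: p) ↔ a ∈ A ∧ w ∈ prod (.star A hA :: p) ∨ a :: w ∈ prod p := by
  constructor
  · rintro ⟨u, v, h, hu, hv⟩
    cases u with
    | nil => exact Or.inr (by simpa [h] using hv)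
    | cons b u =>
      obtain ⟨rfl, rfl⟩ := List.cons.inj h
      exact Or.inl ⟨hu a (by simp), u, v, rfl, fun c hc ↦ hu c (List.mem_cons_of_mem _ hc), hv⟩
  · rintro (⟨ha, u, v, rfl, hu, hv⟩ | h)
    · exact ⟨a :: u, v, rfl, by simpa [Atom.toSet, ha] using hu, hv⟩
    · exact ⟨[], _, rfl, by simp [Atom.toSet], h⟩

theorem Atom.nil_mem (e : Atom X) : [] ∈ e.toSet := by
  cases e <;> simp [Atom.toSet]

theorem prod_subset_prod_cons (e : Atom X) (p : List (Atom X)) : prod p ⊆ prod (e :: p) :=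
  fun w hw ↦ ⟨[], w, rfl, e.nil_mem, hw⟩

theorem nil_mem_prod (p : List (Atom X)) : [] ∈ prod p := by
  induction p with
  | nil => rfl
  | cons e p ih => exact prod_subset_prod_cons e p ih

theorem append_mem_prod_star {A : Closeds X} {hA} {p : List (Atom X)} {u w : List X}
    (hu : ∀ a ∈ u, a ∈ A) (hw : w ∈ prod (.star A hA :: p)) :
    u ++ w ∈ prod (.star A hA :: p) := by
  obtain ⟨x, y, rfl, hx, hy⟩ := hw
  exact ⟨u ++ x, y, by simp, fun a ha ↦ (List.mem_append.1 ha).elim (hu a) (hx a), hy⟩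

/-- A set of words is a union of subbasic open sets. -/
def IsUnionOcc (O : Set (List X)) : Prop :=
  ∀ w ∈ O, ∃ Us : List (Set X), (∀ U ∈ Us, IsOpen U) ∧ w ∈ occ Us ∧ occ Us ⊆ O

theorem IsUnionOcc.isOpen {O : Set (List X)} (h : IsUnionOcc O) :
    IsOpen (X := WordSpace X) O := by
  refine (isOpen_iff_forall_mem_open (X := WordSpace X)).2 fun w hw ↦ ?_
  obtain ⟨Us, hUs, hw, hO⟩ := h w hw
  exact ⟨occ Us, hO, isOpen_occ hUs, hw⟩

theorem IsUnionOcc.exists_occ {O : Set (List X)} (h : IsUnionOcc O) {V : Set X} (hV : IsOpen V)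
    {x y : List X} {a : X} (ha : a ∈ V) (hy : a :: y ∈ O) :
    ∃ Us : List (Set X), (∀ U ∈ Us, IsOpen U) ∧ x ++ a :: y ∈ occ Us ∧
      ∀ w ∈ occ Us, ∃ x b y, w = x ++ b :: y ∧ b ∈ V ∧ b :: y ∈ O := by
  obtain ⟨Us, hUs, hmem, hsub⟩ := h _ hy
  cases Us with
  | nil =>
    refine ⟨[V], by simpa, mem_occ_cons.2 ⟨x, a, y, rfl, ha, by simp⟩, fun w hw ↦ ?_⟩
    obtain ⟨x, b, y, rfl, hb, -⟩ := mem_occ_cons.1 hw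
    exact ⟨x, b, y, rfl, hb, hsub (by simp)⟩
  | cons U Us =>
    obtain h | ⟨haU, h⟩ := cons_mem_occ_cons.1 hmem
    · refine ⟨V :: U :: Us, by simpa using ⟨hV, by simpa using hUs⟩,
        mem_occ_cons.2 ⟨x, a, y, rfl, ha, h⟩, fun w hw ↦ ?_⟩
      obtain ⟨x, b, y, rfl, hb, h⟩ := mem_occ_cons.1 hw
      exact ⟨x, b, y, rfl, hb, hsub (cons_mem_occ_cons.2 (Or.inl h))⟩
    · simp only [List.mem_cons, forall_eq_or_imp] at hUs
      refine ⟨(V ∩ U) :: Us, by simpa using ⟨hV.inter hUs.1, hUs.2⟩,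
        mem_occ_cons.2 ⟨x, a, y, rfl, ⟨ha, haU⟩, h⟩, fun w hw ↦ ?_⟩
      obtain ⟨x, b, y, rfl, hb, h⟩ := mem_occ_cons.1 hw
      exact ⟨x, b, y, rfl, hb.1, hsub (cons_mem_occ_cons.2 (Or.inr ⟨hb.2, h⟩))⟩

theorem mem_prod_of_sublist {p : List (Atom X)} {v w : List X} (h : v.Sublist w)
    (hw : w ∈ prod p) : v ∈ prod p := by
  induction p generalizing v w with
  | nil =>
    rw [mem_prod_nil] at hw ⊢
    subst hw
    exact List.sublist_nil.1 h
  | cons e p ih =>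
    obtain ⟨x, y, rfl, hx, hy⟩ := hw
    obtain ⟨x', y', rfl, hx', hy'⟩ := List.sublist_append_iff.1 h
    refine ⟨x', y', rfl, ?_, ih hy' hy⟩
    cases e with
    | star A hA => exact fun a ha ↦ hx a (hx'.subset ha)
    | opt C =>
      obtain rfl | ⟨c, hc, rfl⟩ := hx
      · exact Or.inl (List.sublist_nil.1 hx')
      · obtain h | h := List.sublist_singleton.1 hx'
        · exact Or.inl h
        · exact Or.inr ⟨c, hc, h⟩

theorem isUnionOcc_compl_prod (p : List (Atom X)) : IsUnionOcc (prod p)ᶜ := by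
  induction p with
  | nil =>
    intro w hw
    refine ⟨[Set.univ], by simp, ?_, fun v hv hv' ↦ ?_⟩
    · cases w with
      | nil => exact absurd rfl hw
      | cons a w => exact mem_occ_cons.2 ⟨[], a, w, rfl, trivial, by simp⟩
    · rw [mem_prod_nil] at hv'
      subst hv'
      simp at hv
  | cons e p ih =>
    intro w hw
    cases e with
    | star A hA =>
      obtain ⟨x, a, y, rfl, ha, hy⟩ : ∃ x a y, w = x ++ a :: y ∧ a ∉ A ∧ a :: y ∉ prod p := by
        induction w with
        | nil => exact absurd (nil_mem_prod _) hw
        | cons a w ih' =>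
          rw [Set.mem_compl_iff, cons_mem_prod_star] at hw
          push Not at hw
          by_cases ha : a ∈ A
          · obtain ⟨x, b, y, rfl, h⟩ := ih' (hw.1 ha)
            exact ⟨a :: x, b, y, rfl, h⟩
          · exact ⟨[], a, w, rfl, ha, hw.2⟩
      obtain ⟨Us, hUs, hmem, h⟩ :=
        ih.exists_occ (x := x) A.isClosed.isOpen_compl (a := a) ha hy
      refine ⟨Us, hUs, hmem, fun w hw hw' ↦ ?_⟩
      obtain ⟨x, b, y, rfl, hb, hy⟩ := h w hw
      obtain ⟨u, v, e, hu, hv⟩ := hw'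
      obtain ⟨z, h1, h2⟩ | ⟨z, h1, h2⟩ := List.append_eq_append_iff.1 e
      · cases z with
        | nil => exact hy (by simpa [h2] using hv)
        | cons c z =>
          obtain ⟨rfl, -⟩ := List.cons.inj h2
          exact hb (hu b (by simp [h1]))
      · exact hy (mem_prod_of_sublist (by simp [h2]) hv)
    | opt C =>
      rw [Set.mem_compl_iff, mem_prod_opt, not_or] at hw
      cases w with
      | nil => exact absurd (nil_mem_prod p) hw.1
      | cons a w =>
        by_cases hp : w ∈ prod p
        · have ha : a ∉ C := fun ha ↦ hw.2 ⟨a, ha, w, hp, rfl⟩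
          obtain ⟨Us, hUs, hmem, h⟩ :=
            ih.exists_occ (x := []) C.isClosed.isOpen_compl (a := a) ha hw.1
          refine ⟨Us, hUs, hmem, fun w hw hw' ↦ ?_⟩
          obtain ⟨x, b, y, rfl, hb, hy⟩ := h w hw
          obtain hw' | ⟨c, hc, v, hv, e⟩ := mem_prod_opt.1 hw'
          · exact hy (mem_prod_of_sublist (by simp) hw')
          · cases x with
            | nil =>
              obtain ⟨rfl, -⟩ := List.cons.inj e
              exact hb hc
            | cons d x =>
              obtain ⟨-, rfl⟩ := List.cons.inj e
              exact hy (mem_prod_of_sublist (by simp) hv)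
        · obtain ⟨Us, hUs, hmem, h⟩ := ih w hp
          refine ⟨Set.univ :: Us, by simpa using hUs,
            cons_mem_occ_cons.2 (Or.inr ⟨trivial, hmem⟩), fun w hw hw' ↦ ?_⟩
          obtain ⟨x, b, y, rfl, -, hy⟩ := mem_occ_cons.1 hw
          refine h hy ?_
          obtain hw' | ⟨c, hc, v, hv, e⟩ := mem_prod_opt.1 hw'
          · exact mem_prod_of_sublist (by simp) hw'
          · cases x with
            | nil =>
              obtain ⟨-, rfl⟩ := List.cons.inj e
              exact hv
            | cons d x =>
              obtain ⟨-, rfl⟩ := List.cons.inj e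
              exact mem_prod_of_sublist (by simp) hv

theorem isClosed_prod (p : List (Atom X)) : IsClosed (X := WordSpace X) (prod p) :=
  ⟨(isUnionOcc_compl_prod p).isOpen⟩

theorem isPreirreducible_prod (p : List (Atom X)) :
    ∀ O₁ O₂ : Set (List X), IsOpen (X := WordSpace X) O₁ → IsOpen (X := WordSpace X) O₂ →
      (∃ w ∈ prod p, w ∈ O₁) → (∃ w ∈ prod p, w ∈ O₂) → ∃ w ∈ prod p, w ∈ O₁ ∧ w ∈ O₂ := by
  induction p with
  | nil =>
    rintro O₁ O₂ - - ⟨w, rfl, h₁⟩ ⟨w', rfl, h₂⟩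
    exact ⟨_, rfl, h₁, h₂⟩
  | cons e p ih =>
    have key : ∀ O₁ O₂ : Set (List X), IsOpen (X := WordSpace X) O₁ →
        IsOpen (X := WordSpace X) O₂ → ∀ u ∈ e.toSet, (∃ v ∈ prod p, u ++ v ∈ O₁) →
        (∃ v ∈ prod p, u ++ v ∈ O₂) → ∃ w ∈ prod (e :: p), w ∈ O₁ ∧ w ∈ O₂ := by
      intro O₁ O₂ hO₁ hO₂ u hu h₁ h₂
      obtain ⟨v, hv, h⟩ := ih _ _ (hO₁.preimage (continuous_append_right u))
        (hO₂.preimage (continuous_append_right u)) h₁ h₂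
      exact ⟨u ++ v, ⟨u, v, rfl, hu, hv⟩, h⟩
    rintro O₁ O₂ hO₁ hO₂ ⟨_, ⟨u₁, v₁, rfl, hu₁, hv₁⟩, h₁⟩ ⟨_, ⟨u₂, v₂, rfl, hu₂, hv₂⟩, h₂⟩
    cases e with
    | star A hA =>
      refine key O₁ O₂ hO₁ hO₂ (u₁ ++ u₂)
        (fun a ha ↦ (List.mem_append.1 ha).elim (hu₁ a) (hu₂ a))
        ⟨v₁, hv₁, mem_of_isOpen_of_sublist hO₁ ?_ h₁⟩ ⟨v₂, hv₂, mem_of_isOpen_of_sublist hO₂ ?_ h₂⟩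
      · simp
      · simp
    | opt C =>
      obtain ⟨c₁, hc₁, hm₁⟩ : ∃ c ∈ C, c :: v₁ ∈ O₁ := by
        obtain rfl | ⟨c, hc, rfl⟩ := hu₁
        · obtain ⟨c, hc⟩ := C.isIrreducible.nonempty
          exact ⟨c, hc, mem_of_isOpen_of_sublist hO₁ (by simp) h₁⟩
        · exact ⟨c, hc, h₁⟩
      obtain ⟨c₂, hc₂, hm₂⟩ : ∃ c ∈ C, c :: v₂ ∈ O₂ := by
        obtain rfl | ⟨c, hc, rfl⟩ := hu₂
        · obtain ⟨c, hc⟩ := C.isIrreducible.nonempty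
          exact ⟨c, hc, mem_of_isOpen_of_sublist hO₂ (by simp) h₂⟩
        · exact ⟨c, hc, h₂⟩
      obtain ⟨c, hc, hc'⟩ := C.isIrreducible.isPreirreducible _ _
        (hO₁.preimage (continuous_cons_left v₁)) (hO₂.preimage (continuous_cons_left v₂))
        ⟨c₁, hc₁, hm₁⟩ ⟨c₂, hc₂, hm₂⟩
      exact key O₁ O₂ hO₁ hO₂ [c] (Or.inr ⟨c, hc, rfl⟩) ⟨v₁, hv₁, hc'.1⟩ ⟨v₂, hv₂, hc'.2⟩

/-- The irreducible closed set of words denoted by a list of atoms. -/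
def prodI (p : List (Atom X)) : IrreducibleCloseds (WordSpace X) where
  carrier := prod p
  isIrreducible' := ⟨⟨[], nil_mem_prod p⟩, fun O₁ O₂ h₁ h₂ ⟨w₁, m₁, n₁⟩ ⟨w₂, m₂, n₂⟩ ↦
    isPreirreducible_prod p O₁ O₂ h₁ h₂ ⟨w₁, m₁, n₁⟩ ⟨w₂, m₂, n₂⟩⟩
  isClosed' := isClosed_prod p

theorem mem_prodI {p : List (Atom X)} {w : WordSpace X} : w ∈ prodI p ↔ w ∈ prod p := Iff.rfl

theorem prodI_le {p q : List (Atom X)} : prodI p ≤ prodI q ↔ prod p ⊆ prod q := Iff.rfl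

end Prod

section Split

variable {X : Type u} [TopologicalSpace X]

theorem prod_opt_subset {A : Closeds X} {C : IrreducibleCloseds X} (hC : ¬ (C : Set X) ⊆ A)
    {p q : List (Atom X)}
    (h : ∀ c ∈ C, ∀ w ∈ prod p, c ∈ A ∨ c :: w ∈ prod q) : prod (.opt C :: p) ⊆ prod q := by
  have key : ∀ w ∈ prod p, ∀ c ∈ C, c :: w ∈ prod q := by
    intro w hw
    have hcl : IsClosed {d : X | d :: w ∈ prod q} :=
      (isClosed_prod q).preimage (continuous_cons_left w)
    exact ((isPreirreducible_iff_isClosed_union_isClosed.1 C.isIrreducible.isPreirreducible)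
      A {d : X | d :: w ∈ prod q} A.isClosed hcl fun c hc ↦ h c hc w hw).resolve_left hC
  intro w hw
  obtain hw | ⟨c, hc, v, hv, rfl⟩ := mem_prod_opt.1 hw
  · obtain ⟨c, hc⟩ := C.isIrreducible.nonempty
    exact mem_prod_of_sublist (List.sublist_cons_self c w) (key w hw c hc)
  · exact key v hv c hc

theorem exists_split_of_prod_subset_star {A : Closeds X} {hA} {q : List (Atom X)} :
    ∀ p : List (Atom X), prod p ⊆ prod (.star A hA :: q) →
    ∃ s t, p = s ++ t ∧ prod t ⊆ prod q ∧ ∀ e ∈ s, e.toSet ⊆ (Atom.star A hA).toSet := by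
  intro p
  induction p with
  | nil => exact fun _ ↦ ⟨[], [], rfl, fun w hw ↦ mem_prod_nil.1 hw ▸ nil_mem_prod q, by simp⟩
  | cons e p ih =>
    intro h
    by_cases he : e.toSet ⊆ (Atom.star A hA).toSet
    · obtain ⟨s, t, rfl, ht, hs⟩ := ih ((prod_subset_prod_cons e p).trans h)
      exact ⟨e :: s, t, rfl, ht, by simpa using ⟨he, hs⟩⟩
    refine ⟨[], e :: p, rfl, ?_, by simp⟩
    cases e with
    | star B hB =>
      obtain ⟨b, hb, hbA⟩ : ∃ b ∈ B, b ∉ A := by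
        by_contra! hBA
        exact he fun w hw a ha ↦ hBA a (hw a ha)
      intro w hw
      have := h (cons_mem_prod_star.2 (Or.inl ⟨hb, hw⟩))
      obtain ⟨hb', -⟩ | this := cons_mem_prod_star.1 this
      · exact absurd hb' hbA
      · exact mem_prod_of_sublist (List.sublist_cons_self b w) this
    | opt C =>
      refine prod_opt_subset (A := A) (fun hC ↦ he ?_) fun c hc w hw ↦ ?_
      · rintro _ (rfl | ⟨c, hc, rfl⟩)
        · exact Atom.nil_mem _
        · intro a ha
          obtain rfl := List.mem_singleton.1 ha
          exact hC hc
      · have := h (mem_prod_opt.2 (Or.inr ⟨c, hc, w, hw, rfl⟩))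
        exact (cons_mem_prod_star.1 this).imp_left And.left

theorem exists_split_of_prod_subset_opt {C' : IrreducibleCloseds X} {p q : List (Atom X)}
    (h : prod p ⊆ prod (.opt C' :: q)) :
    ∃ s t, p = s ++ t ∧ prod t ⊆ prod q ∧ (s = [] ∨ ∃ C ≤ C', s = [.opt C]) := by
  cases p with
  | nil => exact ⟨[], [], rfl, fun w hw ↦ mem_prod_nil.1 hw ▸ nil_mem_prod q, Or.inl rfl⟩
  | cons e p =>
    have hcons : ∀ {a : X} {w : List X}, a :: w ∈ prod (.opt C' :: q) → w ∈ prod q := by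
      intro a w haw
      obtain haw | ⟨c, hc, v, hv, e⟩ := mem_prod_opt.1 haw
      · exact mem_prod_of_sublist (List.sublist_cons_self a w) haw
      · obtain ⟨-, rfl⟩ := List.cons.inj e
        exact hv
    cases e with
    | star B hB =>
      refine ⟨[], _, rfl, fun w hw ↦ ?_, Or.inl rfl⟩
      obtain ⟨b, hb⟩ := hB
      exact hcons (h (cons_mem_prod_star.2 (Or.inl ⟨hb, hw⟩)))
    | opt C =>
      by_cases hC : C ≤ C'
      · refine ⟨[.opt C], p, rfl, fun w hw ↦ ?_, Or.inr ⟨C, hC, rfl⟩⟩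
        obtain ⟨c, hc⟩ := C.isIrreducible.nonempty
        exact hcons (h (mem_prod_opt.2 (Or.inr ⟨c, hc, w, hw, rfl⟩)))
      · refine ⟨[], _, rfl, prod_opt_subset (A := ⟨C', C'.isClosed⟩) hC fun c hc w hw ↦ ?_,
          Or.inl rfl⟩
        obtain h' | ⟨d, hd, v, hv, e⟩ := mem_prod_opt.1 (h (mem_prod_opt.2 (Or.inr ⟨c, hc, w, hw, rfl⟩)))
        · exact Or.inr h'
        · obtain ⟨rfl, -⟩ := List.cons.inj e
          exact Or.inl hd

theorem prod_append_subset {s s' t t' : List (Atom X)} (hs : prod s ⊆ prod s')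
    (ht : prod t ⊆ prod t') : prod (s ++ t) ⊆ prod (s' ++ t') := by
  intro w hw
  obtain ⟨u, v, rfl, hu, hv⟩ := mem_prod_append.1 hw
  exact mem_prod_append.2 ⟨u, v, rfl, hs hu, ht hv⟩

theorem prod_append_congr {s s' t t' : List (Atom X)} (hs : prod s = prod s')
    (ht : prod t = prod t') : prod (s ++ t) = prod (s' ++ t') :=
  (prod_append_subset hs.subset ht.subset).antisymm (prod_append_subset hs.superset ht.superset)

theorem mem_prod_star_singleton {A : Closeds X} {hA} {w : List X} :
    w ∈ prod [.star A hA] ↔ ∀ a ∈ w, a ∈ A := by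
  constructor
  · rintro ⟨u, v, rfl, hu, rfl⟩
    simpa [Atom.toSet] using hu
  · exact fun h ↦ ⟨w, [], by simp, h, rfl⟩

theorem prod_subset_star_singleton {A : Closeds X} {hA} {s : List (Atom X)}
    (hs : ∀ e ∈ s, e.toSet ⊆ (Atom.star A hA).toSet) : prod s ⊆ prod [.star A hA] := by
  induction s with
  | nil => exact fun w hw ↦ mem_prod_nil.1 hw ▸ nil_mem_prod _
  | cons e s ih =>
    rintro _ ⟨u, v, rfl, hu, hv⟩
    rw [mem_prod_star_singleton]
    have h1 := hs e (by simp) hu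
    have h2 := mem_prod_star_singleton.1 (ih (fun e he ↦ hs e (List.mem_cons_of_mem _ he)) hv)
    exact fun a ha ↦ (List.mem_append.1 ha).elim (h1 a) (h2 a)

theorem toSet_subset_prod {e : Atom X} {s : List (Atom X)} (h : e ∈ s) : e.toSet ⊆ prod s := by
  induction s with
  | nil => simp at h
  | cons f s ih =>
    intro w hw
    obtain rfl | h := List.mem_cons.1 h
    · exact ⟨w, [], by simp, hw, nil_mem_prod s⟩
    · exact prod_subset_prod_cons f s (ih h hw)

end Split

section Weight

variable {X : Type u} [TopologicalSpace X]

/-- The ordinal weight of an atom. -/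
noncomputable def Atom.weight : Atom X → Ordinal.{u}
  | .star A _ => ω ^ adjsw (wfRank A)
  | .opt C => wfRank (⟨C, C.isClosed⟩ : Closeds X)

/-- The ordinal weight of a list of atoms. -/
noncomputable def weight (p : List (Atom X)) : Ordinal.{u} :=
  natSum (p.map Atom.weight)

theorem weight_cons (e : Atom X) (p : List (Atom X)) :
    weight (e :: p) = natAdd e.weight (weight p) := natSum_cons _ _

theorem weight_append (p q : List (Atom X)) :
    weight (p ++ q) = natAdd (weight p) (weight q) := by
  rw [weight, List.map_append, natSum_append]; rfl

/-- The least weight of a word product denoting a given set. -/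
noncomputable def minWeight (D : IrreducibleCloseds (WordSpace X)) : Ordinal.{u} :=
  sInf {o | ∃ p : List (Atom X), prodI p = D ∧ o = weight p}

theorem minWeight_prodI_le (p : List (Atom X)) : minWeight (prodI p) ≤ weight p :=
  csInf_le' ⟨p, rfl, rfl⟩

variable [NoetherianSpace X]

theorem Atom.weight_opt_pos (C : IrreducibleCloseds X) : 0 < (Atom.opt C).weight := by
  refine (zero_le (a := wfRank (⊥ : Closeds X))).trans_lt (wfRank_strictMono ?_)
  rw [bot_lt_iff_ne_bot]
  intro h
  obtain ⟨c, hc⟩ := C.isIrreducible.nonempty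
  have : c ∈ (⟨C, C.isClosed⟩ : Closeds X) := hc
  rw [h] at this
  exact this

theorem Atom.weight_lt_star {A : Closeds X} {hA} {e : Atom X}
    (h : e.toSet ⊆ (Atom.star A hA).toSet) (hne : e ≠ .star A hA) :
    e.weight < ω ^ adjsw (wfRank A) := by
  cases e with
  | star B hB =>
    refine (opow_lt_opow_iff_right one_lt_omega0).2 (adjsw_strictMono (wfRank_strictMono ?_))
    have hle : B ≤ A := fun b hb ↦
      h (a := [b]) (by simpa [Atom.toSet] using hb) b (by simp)
    exact hle.lt_of_ne fun hBA ↦ hne (by subst hBA; rfl)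
  | opt C =>
    refine lt_of_le_of_lt (wfRank_mono_s8 ?_) (lt_omega0_opow_adjsw _)
    exact fun c hc ↦ h (a := [c]) (Or.inr ⟨c, hc, rfl⟩) c (by simp)

theorem exists_prod_eq_weight_lt (q : List (Atom X)) :
    ∀ p : List (Atom X), prod p ⊆ prod q →
      ∃ p', prod p' = prod p ∧ (p' = q ∨ weight p' < weight q) := by
  classical
  induction q with
  | nil =>
    intro p h
    refine ⟨[], subset_antisymm ?_ h, Or.inl rfl⟩
    exact fun w hw ↦ mem_prod_nil.1 hw ▸ nil_mem_prod p
  | cons e q ih =>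
    intro p h
    cases e with
    | star A hA =>
      obtain ⟨s, t, rfl, ht, hs⟩ := exists_split_of_prod_subset_star p h
      obtain ⟨t', ht', hlt⟩ := ih t ht
      have hle : weight t' ≤ weight q := by
        obtain rfl | hlt := hlt
        exacts [le_rfl, hlt.le]
      by_cases hAs : .star A hA ∈ s
      · refine ⟨[.star A hA] ++ t', prod_append_congr ?_ ht', ?_⟩
        · refine subset_antisymm (fun w hw ↦ ?_) (prod_subset_star_singleton hs)
          exact toSet_subset_prod hAs (mem_prod_star_singleton.1 hw)
        · obtain rfl | hlt := hlt
          · exact Or.inl rfl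
          · right
            rw [List.singleton_append, weight_cons, weight_cons]
            exact natAdd_lt_natAdd_left hlt _
      · refine ⟨s ++ t', prod_append_congr rfl ht', Or.inr ?_⟩
        rw [weight_append, weight_cons]
        refine (natAdd_lt_natAdd_right (natSum_lt_omega0_opow fun a ha ↦ ?_) _).trans_le
          (natAdd_le_natAdd le_rfl hle)
        obtain ⟨e, he, rfl⟩ := List.mem_map.1 ha
        exact Atom.weight_lt_star (hs e he) fun h ↦ hAs (h ▸ he)
    | opt C' =>
      obtain ⟨s, t, rfl, ht, hs⟩ := exists_split_of_prod_subset_opt h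
      obtain ⟨t', ht', hlt⟩ := ih t ht
      have hle : weight t' ≤ weight q := by
        obtain rfl | hlt := hlt
        exacts [le_rfl, hlt.le]
      obtain rfl | ⟨C, hC, rfl⟩ := hs
      · refine ⟨t', ht', Or.inr ?_⟩
        rw [weight_cons]
        conv_lhs => rw [← zero_natAdd (weight t')]
        exact (natAdd_lt_natAdd_right (Atom.weight_opt_pos C') _).trans_le
          (natAdd_le_natAdd le_rfl hle)
      · refine ⟨[.opt C] ++ t', prod_append_congr rfl ht', ?_⟩
        rw [List.singleton_append, weight_cons, weight_cons]
        obtain rfl | hC := hC.eq_or_lt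
        · obtain rfl | hlt := hlt
          · exact Or.inl rfl
          · exact Or.inr (natAdd_lt_natAdd_left hlt _)
        · have h : (Atom.opt C).weight < (Atom.opt C').weight := wfRank_strictMono hC
          exact Or.inr ((natAdd_lt_natAdd_right h _).trans_le (natAdd_le_natAdd le_rfl hle))

theorem minWeight_lt_minWeight {p q : List (Atom X)} (h : prodI p < prodI q) :
    minWeight (prodI p) < minWeight (prodI q) := by
  obtain ⟨q', hq', e⟩ := csInf_mem
    (s := {o | ∃ q' : List (Atom X), prodI q' = prodI q ∧ o = weight q'}) ⟨_, q, rfl, rfl⟩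
  rw [← hq'] at h
  obtain ⟨p', hp', rfl | hlt⟩ := exists_prod_eq_weight_lt q' p (prodI_le.1 h.le)
  · exact absurd (prodI_le.2 hp'.subset) h.not_ge
  · have : prodI p' = prodI p := le_antisymm (prodI_le.2 hp'.subset) (prodI_le.2 hp'.superset)
    rw [← this]
    exact (minWeight_prodI_le p').trans_lt (hlt.trans_eq e.symm)

end Weight

section FiniteUnion

variable {X : Type u}

/-- The concatenations of a word over `A` and a word in `S`. -/
def starMul (A : Set X) (S : Set (List X)) : Set (List X) :=
  {w | ∃ u v, w = u ++ v ∧ (∀ a ∈ u, a ∈ A) ∧ v ∈ S}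

/-- The words in `S`, possibly preceded by a letter in `A`. -/
def optMul (A : Set X) (S : Set (List X)) : Set (List X) :=
  {w | w ∈ S ∨ ∃ c ∈ A, ∃ v ∈ S, w = c :: v}

theorem subset_starMul (A : Set X) (S : Set (List X)) : S ⊆ starMul A S :=
  fun w hw ↦ ⟨[], w, rfl, by simp, hw⟩

theorem cons_mem_starMul {A : Set X} {S : Set (List X)} {a : X} {w : List X} (ha : a ∈ A)
    (hw : w ∈ starMul A S) : a :: w ∈ starMul A S := by
  obtain ⟨u, v, rfl, hu, hv⟩ := hw
  exact ⟨a :: u, v, rfl, by simpa [ha] using hu, hv⟩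

theorem compl_occ_cons {U : Set X} {Us : List (Set X)} :
    (occ (U :: Us))ᶜ = starMul Uᶜ ({[]} ∪ optMul Set.univ (occ Us)ᶜ) := by
  have hsub : occ (U :: Us) ⊆ occ Us := fun w hw ↦ by
    obtain ⟨x, a, y, rfl, -, hy⟩ := mem_occ_cons.1 hw
    exact mem_occ_of_sublist (by simp) hy
  apply subset_antisymm
  · intro w hw
    induction w with
    | nil => exact subset_starMul _ _ (Or.inl rfl)
    | cons a w ih =>
      rw [Set.mem_compl_iff, cons_mem_occ_cons, not_or, not_and] at hw
      by_cases ha : a ∈ U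
      · exact subset_starMul _ _ (Or.inr (Or.inr ⟨a, trivial, w, hw.2 ha, rfl⟩))
      · exact cons_mem_starMul ha (ih hw.1)
  · rintro _ ⟨u, v, rfl, hu, hv⟩
    induction u with
    | nil =>
      obtain rfl | hv | ⟨c, -, v, hv, rfl⟩ := hv
      · exact nil_notMem_occ_cons _ _
      · exact fun h ↦ hv (hsub h)
      · rw [List.nil_append, Set.mem_compl_iff, cons_mem_occ_cons]
        rintro (h | ⟨-, h⟩)
        exacts [hv (hsub h), hv h]
    | cons a u ih =>
      simp only [List.mem_cons, forall_eq_or_imp] at hu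
      rw [List.cons_append, Set.mem_compl_iff, cons_mem_occ_cons]
      rintro (h | ⟨h, -⟩)
      exacts [ih hu.2 h, hu.1 h]

variable [TopologicalSpace X]

/-- A set of words is a finite union of word products. -/
def IsFiniteUnionProd (S : Set (List X)) : Prop :=
  ∃ L : List (List (Atom X)), ∀ w, w ∈ S ↔ ∃ r ∈ L, w ∈ prod r

theorem isFiniteUnionProd_empty : IsFiniteUnionProd (∅ : Set (List X)) :=
  ⟨[], by simp⟩

theorem isFiniteUnionProd_prod (p : List (Atom X)) : IsFiniteUnionProd (prod p) :=
  ⟨[p], by simp⟩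

theorem IsFiniteUnionProd.union {S T : Set (List X)} (hS : IsFiniteUnionProd S)
    (hT : IsFiniteUnionProd T) : IsFiniteUnionProd (S ∪ T) := by
  obtain ⟨L, hL⟩ := hS
  obtain ⟨M, hM⟩ := hT
  exact ⟨L ++ M, fun w ↦ by simp [hL, hM, or_and_right, exists_or]⟩

theorem isFiniteUnionProd_biUnion {ι : Type*} {L : List ι} {f : ι → Set (List X)}
    (h : ∀ i ∈ L, IsFiniteUnionProd (f i)) : IsFiniteUnionProd {w | ∃ i ∈ L, w ∈ f i} := by
  induction L with
  | nil => simpa using isFiniteUnionProd_empty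
  | cons i L ih =>
    simp only [List.mem_cons, forall_eq_or_imp] at h
    convert h.1.union (ih h.2) using 1
    ext w
    simp

theorem IsFiniteUnionProd.starMul {A : Set X} {S : Set (List X)} (hA : IsClosed A)
    (hS : IsFiniteUnionProd S) : IsFiniteUnionProd (starMul A S) := by
  obtain rfl | hne := A.eq_empty_or_nonempty
  · convert hS using 1
    refine subset_antisymm ?_ (subset_starMul _ _)
    rintro _ ⟨u, v, rfl, hu, hv⟩
    obtain rfl : u = [] := List.eq_nil_iff_forall_not_mem.2 hu
    exact hv
  · obtain ⟨L, hL⟩ := hS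
    refine ⟨L.map (.star ⟨A, hA⟩ hne :: ·), fun w ↦ ?_⟩
    simp only [List.mem_map, exists_exists_and_eq_and]
    constructor
    · rintro ⟨u, v, rfl, hu, hv⟩
      obtain ⟨r, hr, hv⟩ := (hL v).1 hv
      exact ⟨r, hr, u, v, rfl, hu, hv⟩
    · rintro ⟨r, hr, u, v, rfl, hu, hv⟩
      exact ⟨u, v, rfl, hu, (hL v).2 ⟨r, hr, hv⟩⟩

theorem IsFiniteUnionProd.exists_list_range {S : Set (List X)} (h : IsFiniteUnionProd S) :
    ∃ L : List (IrreducibleCloseds (WordSpace X)), (∀ C ∈ L, C ∈ Set.range prodI) ∧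
      ∀ y : WordSpace X, y ∈ S ↔ ∃ C ∈ L, y ∈ C := by
  obtain ⟨L, hL⟩ := h
  refine ⟨L.map prodI, fun C hC ↦ ?_, fun y ↦ (hL y).trans ?_⟩
  · obtain ⟨r, -, rfl⟩ := List.mem_map.1 hC
    exact ⟨r, rfl⟩
  · simp only [List.mem_map, exists_exists_and_eq_and]
    rfl

theorem isFiniteUnionProd_univ : IsFiniteUnionProd (Set.univ : Set (List X)) := by
  convert (isFiniteUnionProd_prod (X := X) []).starMul isClosed_univ using 1
  exact (Set.eq_univ_of_forall (s := starMul Set.univ (prod []))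
    fun w ↦ ⟨w, [], by simp, fun _ _ ↦ trivial, rfl⟩).symm

variable [NoetherianSpace X]

theorem IsFiniteUnionProd.optMul {A : Set X} {S : Set (List X)} (hA : IsClosed A)
    (hS : IsFiniteUnionProd S) : IsFiniteUnionProd (optMul A S) := by
  obtain ⟨M, hM⟩ := Closeds.exists_list_irreducibleCloseds ⟨A, hA⟩
  have h : IsFiniteUnionProd {w | ∃ C ∈ M, ∃ v ∈ S, ∃ c ∈ C, w = c :: v ∨ w = v} := by
    obtain ⟨L, hL⟩ := id hS
    refine isFiniteUnionProd_biUnion (f := fun C : IrreducibleCloseds X ↦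
      {w | ∃ v ∈ S, ∃ c ∈ C, w = c :: v ∨ w = v}) fun C _ ↦ ?_
    refine ⟨L.map (.opt C :: ·), fun w ↦ ?_⟩
    simp only [List.mem_map, exists_exists_and_eq_and, mem_prod_opt, Set.mem_ofPred_eq]
    constructor
    · rintro ⟨v, hv, c, hc, rfl | rfl⟩ <;> obtain ⟨r, hr, hv⟩ := (hL _).1 hv
      · exact ⟨r, hr, Or.inr ⟨c, hc, v, hv, rfl⟩⟩
      · exact ⟨r, hr, Or.inl hv⟩
    · rintro ⟨r, hr, hv | ⟨c, hc, v, hv, rfl⟩⟩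
      · obtain ⟨c, hc⟩ := C.isIrreducible.nonempty
        exact ⟨w, (hL w).2 ⟨r, hr, hv⟩, c, hc, Or.inr rfl⟩
      · exact ⟨v, (hL v).2 ⟨r, hr, hv⟩, c, hc, Or.inl rfl⟩
  convert hS.union h using 1
  ext w
  constructor
  · rintro (hw | ⟨c, hc, v, hv, rfl⟩)
    · exact Or.inl hw
    · obtain ⟨C, hC, hc⟩ := (hM c).1 hc
      exact Or.inr ⟨C, hC, v, hv, c, hc, Or.inl rfl⟩
  · rintro (hw | ⟨C, hC, v, hv, c, hc, rfl | rfl⟩)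
    · exact Or.inl hw
    · exact Or.inr ⟨c, (hM c).2 ⟨C, hC, hc⟩, v, hv, rfl⟩
    · exact Or.inl hv

theorem isFiniteUnionProd_prod_inter_prod : ∀ p q : List (Atom X),
    IsFiniteUnionProd (prod p ∩ prod q)
  | [], q => by
    convert isFiniteUnionProd_prod (X := X) [] using 1
    exact Set.inter_eq_left.2 fun w hw ↦ mem_prod_nil.1 hw ▸ nil_mem_prod q
  | p, [] => by
    convert isFiniteUnionProd_prod (X := X) [] using 1
    exact Set.inter_eq_right.2 fun w hw ↦ mem_prod_nil.1 hw ▸ nil_mem_prod p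
  | .star A hA :: p, .star B hB :: q => by
    have h₁ := isFiniteUnionProd_prod_inter_prod (.star A hA :: p) q
    have h₂ := isFiniteUnionProd_prod_inter_prod p (.star B hB :: q)
    convert (h₁.union h₂).starMul (A.isClosed.inter B.isClosed) using 1
    apply subset_antisymm
    · rintro w ⟨hw, hw'⟩
      induction w with
      | nil => exact subset_starMul _ _ (Or.inl ⟨nil_mem_prod _, nil_mem_prod _⟩)
      | cons a w ih =>
        obtain ⟨ha, h⟩ | h := cons_mem_prod_star.1 hw
        · obtain ⟨ha', h'⟩ | h' := cons_mem_prod_star.1 hw'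
          · exact cons_mem_starMul ⟨ha, ha'⟩ (ih h h')
          · exact subset_starMul _ _ (Or.inl ⟨hw, h'⟩)
        · exact subset_starMul _ _ (Or.inr ⟨h, hw'⟩)
    · rintro _ ⟨u, v, rfl, hu, hv⟩
      have hv' : v ∈ prod (.star A hA :: p) ∧ v ∈ prod (.star B hB :: q) :=
        hv.elim (fun h ↦ ⟨h.1, prod_subset_prod_cons _ _ h.2⟩)
          fun h ↦ ⟨prod_subset_prod_cons _ _ h.1, h.2⟩
      exact ⟨append_mem_prod_star (fun a ha ↦ (hu a ha).1) hv'.1,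
        append_mem_prod_star (fun a ha ↦ (hu a ha).2) hv'.2⟩
  | .opt C :: p, .opt D :: q => by
    have h₁ := isFiniteUnionProd_prod_inter_prod (.opt C :: p) q
    have h₂ := isFiniteUnionProd_prod_inter_prod p (.opt D :: q)
    have h₃ := isFiniteUnionProd_prod_inter_prod p q
    convert (h₁.union h₂).union (h₃.optMul (C.isClosed.inter D.isClosed)) using 1
    apply subset_antisymm
    · rintro w ⟨hw, hw'⟩
      obtain h | ⟨c, hc, v, hv, rfl⟩ := mem_prod_opt.1 hw
      · exact Or.inl (Or.inr ⟨h, hw'⟩)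
      · obtain h' | ⟨d, hd, v', hv', e⟩ := mem_prod_opt.1 hw'
        · exact Or.inl (Or.inl ⟨hw, h'⟩)
        · obtain ⟨rfl, rfl⟩ := List.cons.inj e
          exact Or.inr (Or.inr ⟨c, ⟨hc, hd⟩, v, ⟨hv, hv'⟩, rfl⟩)
    · rintro w ((⟨h, h'⟩ | ⟨h, h'⟩) | ⟨h, h'⟩ | ⟨c, ⟨hc, hd⟩, v, ⟨hv, hv'⟩, rfl⟩)
      · exact ⟨h, prod_subset_prod_cons _ _ h'⟩
      · exact ⟨prod_subset_prod_cons _ _ h, h'⟩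
      · exact ⟨prod_subset_prod_cons _ _ h, prod_subset_prod_cons _ _ h'⟩
      · exact ⟨mem_prod_opt.2 (Or.inr ⟨c, hc, v, hv, rfl⟩),
          mem_prod_opt.2 (Or.inr ⟨c, hd, v, hv', rfl⟩)⟩
  | .star A hA :: p, .opt C :: q => by
    have h₁ := isFiniteUnionProd_prod_inter_prod (.star A hA :: p) q
    have h₂ := isFiniteUnionProd_prod_inter_prod p (.opt C :: q)
    convert h₂.union (h₁.optMul (A.isClosed.inter C.isClosed)) using 1
    apply subset_antisymm
    · rintro w ⟨hw, hw'⟩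
      obtain h' | ⟨c, hc, v, hv, rfl⟩ := mem_prod_opt.1 hw'
      · exact Or.inr (Or.inl ⟨hw, h'⟩)
      · obtain ⟨ha, h⟩ | h := cons_mem_prod_star.1 hw
        · exact Or.inr (Or.inr ⟨c, ⟨ha, hc⟩, v, ⟨h, hv⟩, rfl⟩)
        · exact Or.inl ⟨h, hw'⟩
    · rintro w (⟨h, h'⟩ | ⟨h, h'⟩ | ⟨c, ⟨hc, hd⟩, v, ⟨hv, hv'⟩, rfl⟩)
      · exact ⟨prod_subset_prod_cons _ _ h, h'⟩
      · exact ⟨h, prod_subset_prod_cons _ _ h'⟩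
      · exact ⟨cons_mem_prod_star.2 (Or.inl ⟨hc, hv⟩),
          mem_prod_opt.2 (Or.inr ⟨c, hd, v, hv', rfl⟩)⟩
  | .opt C :: p, .star A hA :: q => by
    rw [Set.inter_comm]
    have h₁ := isFiniteUnionProd_prod_inter_prod p (.star A hA :: q)
    have h₂ := isFiniteUnionProd_prod_inter_prod (.opt C :: p) q
    rw [Set.inter_comm] at h₁ h₂
    convert h₂.union (h₁.optMul (A.isClosed.inter C.isClosed)) using 1
    apply subset_antisymm
    · rintro w ⟨hw, hw'⟩
      obtain h' | ⟨c, hc, v, hv, rfl⟩ := mem_prod_opt.1 hw'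
      · exact Or.inr (Or.inl ⟨hw, h'⟩)
      · obtain ⟨ha, h⟩ | h := cons_mem_prod_star.1 hw
        · exact Or.inr (Or.inr ⟨c, ⟨ha, hc⟩, v, ⟨h, hv⟩, rfl⟩)
        · exact Or.inl ⟨h, hw'⟩
    · rintro w (⟨h, h'⟩ | ⟨h, h'⟩ | ⟨c, ⟨hc, hd⟩, v, ⟨hv, hv'⟩, rfl⟩)
      · exact ⟨prod_subset_prod_cons _ _ h, h'⟩
      · exact ⟨h, prod_subset_prod_cons _ _ h'⟩
      · exact ⟨cons_mem_prod_star.2 (Or.inl ⟨hc, hv⟩),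
          mem_prod_opt.2 (Or.inr ⟨c, hd, v, hv', rfl⟩)⟩
termination_by p q => p.length + q.length

theorem IsFiniteUnionProd.inter {S T : Set (List X)} (hS : IsFiniteUnionProd S)
    (hT : IsFiniteUnionProd T) : IsFiniteUnionProd (S ∩ T) := by
  obtain ⟨L, hL⟩ := hS
  obtain ⟨M, hM⟩ := hT
  convert isFiniteUnionProd_biUnion (L := L) (f := fun r ↦ {w | ∃ s ∈ M, w ∈ prod r ∩ prod s})
    fun r _ ↦ isFiniteUnionProd_biUnion fun s _ ↦ isFiniteUnionProd_prod_inter_prod r s using 1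
  ext w
  simp only [Set.mem_inter_iff, hL, hM, Set.mem_ofPred_eq]
  grind

theorem isFiniteUnionProd_compl_occ {Us : List (Set X)} (h : ∀ U ∈ Us, IsOpen U) :
    IsFiniteUnionProd (occ Us)ᶜ := by
  induction Us with
  | nil =>
    convert isFiniteUnionProd_empty (X := X) using 1
    exact Set.compl_empty_iff.2 (Set.eq_univ_of_forall mem_occ_nil)
  | cons U Us ih =>
    simp only [List.mem_cons, forall_eq_or_imp] at h
    rw [compl_occ_cons]
    exact ((isFiniteUnionProd_prod []).union ((ih h.2).optMul isClosed_univ)).starMul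
      h.1.isClosed_compl

theorem minWeight_lt_of_mem_range : ∀ C ∈ Set.range (prodI (X := X)),
    ∀ D ∈ Set.range (prodI (X := X)), C < D → minWeight C < minWeight D := by
  rintro _ ⟨p, rfl⟩ _ ⟨q, rfl⟩ h
  exact minWeight_lt_minWeight h

theorem isFiniteUnionProd_sInter {𝒢 : Set (Set (List X))} (h : ∀ S ∈ 𝒢, IsFiniteUnionProd S) :
    IsFiniteUnionProd (⋂₀ 𝒢) := by
  obtain ⟨T, ⟨hT, hle⟩, hmin⟩ := WellFounded.has_min
    (InvImage.wf (fun S : Set (List X) ↦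
      unionRank (Y := WordSpace X) (Set.range prodI) minWeight S) Ordinal.lt_wf)
    {T | IsFiniteUnionProd T ∧ ⋂₀ 𝒢 ⊆ T} ⟨Set.univ, isFiniteUnionProd_univ, Set.subset_univ _⟩
  convert hT using 1
  refine hle.antisymm (Set.subset_sInter fun G hG ↦ ?_)
  by_contra hTG
  have hFG := hT.inter (h G hG)
  refine hmin (T ∩ G) ⟨hFG, Set.subset_inter hle (Set.sInter_subset_of_mem hG)⟩ ?_
  refine unionRank_lt (Y := WordSpace X) minWeight_lt_of_mem_range ?_ hFG.exists_list_range
    hT.exists_list_range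
  exact ⟨Set.inter_subset_left, fun h ↦ hTG (h.trans Set.inter_subset_right)⟩

theorem isFiniteUnionProd_of_isClosed {F : Set (List X)} (hF : IsClosed (X := WordSpace X) F) :
    IsFiniteUnionProd F := by
  suffices ∀ O : Set (List X), IsOpen (X := WordSpace X) O → IsFiniteUnionProd Oᶜ by
    simpa using this Fᶜ hF.isOpen_compl
  intro O hO
  induction hO with
  | basic s hs =>
    obtain ⟨Us, hUs, rfl⟩ := hs
    exact isFiniteUnionProd_compl_occ hUs
  | univ =>
    convert isFiniteUnionProd_empty (X := X) using 1
    exact Set.compl_univ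
  | inter s t _ _ hs ht =>
    convert hs.union ht using 1
    exact Set.compl_inter s t
  | sUnion S _ ih =>
    convert isFiniteUnionProd_sInter (𝒢 := compl '' S) (by rintro _ ⟨s, hs, rfl⟩; exact ih s hs)
      using 1
    exact Set.compl_sUnion S

instance : NoetherianSpace (WordSpace X) := by
  have := wellFoundedLT_closeds_of_forall_union (Y := WordSpace X) minWeight_lt_of_mem_range
    fun F ↦ (isFiniteUnionProd_of_isClosed F.isClosed).exists_list_range
  exact (noetherianSpace_TFAE (WordSpace X)).out 1 0 |>.1 this

theorem exists_prodI_eq (D : IrreducibleCloseds (WordSpace X)) : ∃ p, prodI p = D := by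
  obtain ⟨L, hLK, hL⟩ := (isFiniteUnionProd_of_isClosed D.isClosed).exists_list_range
  obtain ⟨C, hC, hDC⟩ := IrreducibleCloseds.exists_le_of_forall_mem fun y hy ↦ (hL y).1 hy
  obtain ⟨p, rfl⟩ := hLK C hC
  exact ⟨p, le_antisymm (fun y hy ↦ (hL y).2 ⟨_, hC, hy⟩) hDC⟩

theorem wfRank_le_minWeight (D : IrreducibleCloseds (WordSpace X)) : wfRank D ≤ minWeight D :=
  wfRank_le_of_forall_lt_s8 (fun C D h ↦
    minWeight_lt_of_mem_range C (exists_prodI_eq C) D (exists_prodI_eq D) h) D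

end FiniteUnion

section LowerBound

variable {X : Type u} [TopologicalSpace X]

open Classical in
/-- A word product denoting the set of words over a possibly empty closed set. -/
noncomputable def starList (A : Closeds X) : List (Atom X) :=
  if h : (A : Set X).Nonempty then [.star A h] else []

theorem mem_prod_starList {A : Closeds X} {w : List X} :
    w ∈ prod (starList A) ↔ ∀ a ∈ w, a ∈ A := by
  unfold starList
  split_ifs with h
  · exact mem_prod_star_singleton
  · rw [mem_prod_nil]
    refine ⟨fun h ↦ by simp [h], fun hw ↦ List.eq_nil_iff_forall_not_mem.2 fun a ha ↦ ?_⟩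
    exact h ⟨a, hw a ha⟩

/-- The word product `A* C? A* C? ⋯ A* C?` with `n` factors `C?`. -/
noncomputable def starOpt (A : Closeds X) (C : IrreducibleCloseds X) : ℕ → List (Atom X)
  | 0 => []
  | n + 1 => starList A ++ .opt C :: starOpt A C n

open Classical in
theorem countP_le_of_mem_prod_starOpt {A : Closeds X} {C : IrreducibleCloseds X} {n : ℕ}
    {w : List X} (hw : w ∈ prod (starOpt A C n)) : w.countP (· ∉ A) ≤ n := by
  induction n generalizing w with
  | zero =>
    obtain rfl := mem_prod_nil.1 hw
    simp
  | succ n ih =>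
    obtain ⟨u, v, rfl, hu, hv⟩ := mem_prod_append.1 hw
    rw [mem_prod_starList] at hu
    have hu0 : u.countP (· ∉ A) = 0 := List.countP_eq_zero.2 fun a ha ↦ by simpa using hu a ha
    rw [List.countP_append, hu0]
    obtain hv | ⟨c, -, v', hv', rfl⟩ := mem_prod_opt.1 hv
    · have := ih hv
      lia
    · have := ih hv'
      rw [List.countP_cons]
      split_ifs <;> lia

theorem replicate_mem_prod_starOpt {A : Closeds X} {C : IrreducibleCloseds X} {b : X} (hb : b ∈ C)
    (n : ℕ) : List.replicate n b ∈ prod (starOpt A C n) := by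
  induction n with
  | zero => rfl
  | succ n ih =>
    exact mem_prod_append.2 ⟨[], _, rfl, nil_mem_prod _,
      mem_prod_opt.2 (Or.inr ⟨b, hb, _, ih, rfl⟩)⟩

open Classical in
theorem not_append_replicate_mem {A : Closeds X} {C : IrreducibleCloseds X} {b : X} (hb : b ∉ A)
    {n : ℕ} {z : List X} (h : z ++ List.replicate (n + 1) b ∈ prod (starOpt A C n)) : False := by
  have := countP_le_of_mem_prod_starOpt h
  rw [List.countP_append, List.countP_replicate, if_pos (by simpa using hb)] at this
  lia

theorem eq_nil_of_append_replicate_mem {A : Closeds X} {C : IrreducibleCloseds X} {b : X}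
    (hb : b ∉ A) {n : ℕ} {z : List X}
    (h : z ++ List.replicate (n + 1) b ∈ prod (.opt C :: starOpt A C n)) : z = [] := by
  obtain h | ⟨c, hc, v, hv, e⟩ := mem_prod_opt.1 h
  · exact (not_append_replicate_mem hb h).elim
  · cases z with
    | nil => rfl
    | cons d z =>
      obtain ⟨-, rfl⟩ := List.cons.inj e
      exact (not_append_replicate_mem hb hv).elim

theorem prod_opt_subset_starList {A : Closeds X} {C : IrreducibleCloseds X} {p : List (Atom X)}
    (hC : (C : Set X) ⊆ A) (hp : prod p ⊆ prod (starList A)) :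
    prod (.opt C :: p) ⊆ prod (starList A) := by
  intro w hw
  obtain hw | ⟨c, hc, v, hv, rfl⟩ := mem_prod_opt.1 hw
  · exact hp hw
  · have := mem_prod_starList.1 (hp hv)
    exact mem_prod_starList.2 (by simpa using ⟨hC hc, this⟩)

theorem prod_starOpt_subset_starList {A A' : Closeds X} {C : IrreducibleCloseds X} (hA : A ≤ A')
    (hC : (C : Set X) ⊆ A') (n : ℕ) : prod (starOpt A C n) ⊆ prod (starList A') := by
  induction n with
  | zero => exact fun w hw ↦ mem_prod_nil.1 hw ▸ nil_mem_prod _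
  | succ n ih =>
    intro w hw
    obtain ⟨u, v, rfl, hu, hv⟩ := mem_prod_append.1 hw
    have hv := mem_prod_starList.1 (prod_opt_subset_starList hC ih hv)
    exact mem_prod_starList.2 fun a ha ↦
      (List.mem_append.1 ha).elim (fun h ↦ hA (mem_prod_starList.1 hu a h)) (hv a)

theorem length_le_of_mem_prod_replicate {C : IrreducibleCloseds X} {n : ℕ} {w : List X}
    (hw : w ∈ prod (List.replicate n (.opt C))) : w.length ≤ n := by
  induction n generalizing w with
  | zero =>
    obtain rfl := mem_prod_nil.1 hw
    simp
  | succ n ih =>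
    obtain hw | ⟨c, -, v, hv, rfl⟩ := mem_prod_opt.1 hw
    · exact (ih hw).trans (Nat.le_succ n)
    · exact Nat.succ_le_succ (ih hv)

theorem replicate_mem_prod_replicate {C : IrreducibleCloseds X} {c : X} (hc : c ∈ C) (n : ℕ) :
    List.replicate n c ∈ prod (List.replicate n (.opt C)) := by
  induction n with
  | zero => rfl
  | succ n ih => exact mem_prod_opt.2 (Or.inr ⟨c, hc, _, ih, rfl⟩)

theorem mem_of_replicate_mem_prod {C D : IrreducibleCloseds X} {d : X} {n : ℕ}
    (h : List.replicate (n + 1) d ∈ prod (.opt D :: List.replicate n (.opt C))) : d ∈ D := by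
  obtain h | ⟨c, hc, v, -, e⟩ := mem_prod_opt.1 h
  · simpa using length_le_of_mem_prod_replicate h
  · obtain ⟨rfl, -⟩ := List.cons.inj e
    exact hc

theorem prodI_le_starList_top (D : IrreducibleCloseds (WordSpace X)) :
    D ≤ prodI (starList ⊤) :=
  fun _ _ ↦ mem_prodI.2 (mem_prod_starList.2 fun _ _ ↦ trivial)

variable [NoetherianSpace X]

/-- A word product denoting a given irreducible closed set of words. -/
noncomputable def repr (D : IrreducibleCloseds (WordSpace X)) : List (Atom X) :=
  (exists_prodI_eq D).choose

theorem prodI_repr (D : IrreducibleCloseds (WordSpace X)) : prodI (repr D) = D :=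
  (exists_prodI_eq D).choose_spec

theorem mem_prod_repr {D : IrreducibleCloseds (WordSpace X)} {w : WordSpace X} :
    w ∈ prod (repr D) ↔ w ∈ D := by
  conv_rhs => rw [← prodI_repr D]
  exact mem_prodI.symm

theorem wfRank_opt_starOpt_add_le {A : Closeds X} {C : IrreducibleCloseds X} {b : X} (hb : b ∉ A)
    (hC : b ∈ C) (n : ℕ) :
    wfRank (prodI (.opt C :: starOpt A C n)) + wfRank (prodI (starList A)) ≤
      wfRank (prodI (starOpt A C (n + 1))) := by
  have h := wfRank_add_le (q := prodI (.opt C :: starOpt A C n)) (a := prodI (starList A))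
    (g := fun D : IrreducibleCloseds (WordSpace X) ↦
      prodI (repr D ++ .opt C :: starOpt A C n)) ?_ ?_
  · refine h.trans (wfRank_mono_s8 (prodI_le.2 (prod_append_subset ?_ subset_rfl)))
    exact fun w hw ↦ mem_prod_repr.1 hw
  · intro D D' hlt hD'
    refine lt_of_le_not_ge (prodI_le.2 (prod_append_subset ?_ subset_rfl)) fun hle ↦ ?_
    · exact fun w hw ↦ mem_prod_repr.2 (hlt.le (mem_prod_repr.1 hw))
    · obtain ⟨w, hw', hw⟩ := Set.not_subset.1 hlt.not_ge
      have hmem := prodI_le.1 hle (mem_prod_append.2 ⟨w, List.replicate (n + 1) b, rfl,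
        mem_prod_repr.2 hw', mem_prod_opt.2 (Or.inr ⟨b, hC, _, replicate_mem_prod_starOpt hC n,
          rfl⟩)⟩)
      obtain ⟨u, v, e, hu, hv⟩ := mem_prod_append.1 hmem
      replace hu := mem_prod_repr.1 hu
      have huA : ∀ a ∈ u, a ∈ A := mem_prod_starList.1 (hD' (hlt.le hu))
      obtain ⟨z, h1, h2⟩ | ⟨z, h1, h2⟩ := List.append_eq_append_iff.1 e
      · obtain rfl : z = [] := by
          refine List.eq_nil_iff_forall_not_mem.2 fun a ha ↦ hb ?_
          have : a ∈ List.replicate (n + 1) b := h2 ▸ List.mem_append_left _ ha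
          rw [← List.eq_of_mem_replicate this]
          exact huA a (h1 ▸ List.mem_append_right _ ha)
        replace h1 := h1.trans (List.append_nil _)
        exact hw (h1 ▸ hu)
      · rw [h2] at hv
        obtain rfl := eq_nil_of_append_replicate_mem hb hv
        replace h1 := h1.trans (List.append_nil _)
        exact hw (h1 ▸ hu)
  · intro D _
    exact prodI_le.2 fun w hw ↦ mem_prod_append.2 ⟨[], w, rfl, nil_mem_prod _, hw⟩

theorem wfRank_starOpt_lt {A : Closeds X} {C : IrreducibleCloseds X} {b : X} (hb : b ∉ A)
    (hC : b ∈ C) (n : ℕ) :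
    wfRank (prodI (starOpt A C n)) < wfRank (prodI (.opt C :: starOpt A C n)) := by
  refine wfRank_strictMono (lt_of_le_not_ge (prodI_le.2 (prod_subset_prod_cons _ _)) fun h ↦ ?_)
  exact not_append_replicate_mem (z := []) hb (prodI_le.1 h
    (mem_prod_opt.2 (Or.inr ⟨b, hC, _, replicate_mem_prod_starOpt hC n, rfl⟩)))

theorem mul_omega0_le_wfRank_starList {A A' : Closeds X} (h : A < A') :
    (wfRank (prodI (starList A)) + 1) * ω ≤ wfRank (prodI (starList A')) := by
  obtain ⟨b, hb', hb⟩ := Set.not_subset.1 h.not_ge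
  let C : IrreducibleCloseds X := ⟨closure {b}, isIrreducible_singleton.closure, isClosed_closure⟩
  have hC : b ∈ C := subset_closure rfl
  have hCA : (C : Set X) ⊆ A' := closure_minimal (by simpa using hb') A'.isClosed
  have key : ∀ n : ℕ, (wfRank (prodI (starList A)) + 1) * n ≤
      wfRank (prodI (.opt C :: starOpt A C n)) := by
    intro n
    induction n with
    | zero => simp
    | succ n ih =>
      rw [Nat.cast_add_one, mul_add_one, ← add_assoc]
      refine Order.add_one_le_of_lt (lt_of_le_of_lt ?_ (wfRank_starOpt_lt hb hC (n + 1)))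
      exact le_trans (by gcongr) (wfRank_opt_starOpt_add_le hb hC n)
  rw [mul_le_iff_of_isSuccLimit isSuccLimit_omega0]
  intro o ho
  obtain ⟨n, rfl⟩ := lt_omega0.1 ho
  exact (key n).trans (wfRank_mono_s8 (prodI_le.2
    (prod_opt_subset_starList hCA (prod_starOpt_subset_starList h.le hCA n))))

theorem wfRank_mul_omega0_le_wfRank_starList {A : Closeds X} {C : IrreducibleCloseds X}
    (hCA : (C : Set X) ⊆ A) : wfRank C * ω ≤ wfRank (prodI (starList A)) := by
  have key : ∀ n : ℕ, wfRank C * n ≤ wfRank (prodI (List.replicate n (.opt C))) := by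
    intro n
    induction n with
    | zero => simp
    | succ n ih =>
      rw [Nat.cast_add_one, mul_add_one]
      refine le_trans (by gcongr) (wfRank_add_le (q := prodI (List.replicate n (.opt C))) (a := C)
        (g := fun D : IrreducibleCloseds X ↦ prodI (.opt D :: List.replicate n (.opt C))) ?_ ?_)
      · intro D D' hlt hD'
        refine lt_of_le_not_ge (prodI_le.2 fun w hw ↦ ?_) fun hle ↦ ?_
        · obtain hw | ⟨c, hc, v, hv, rfl⟩ := mem_prod_opt.1 hw
          · exact prod_subset_prod_cons _ _ hw
          · exact mem_prod_opt.2 (Or.inr ⟨c, hlt.le hc, v, hv, rfl⟩)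
        · obtain ⟨d, hd', hd⟩ := Set.not_subset.1 hlt.not_ge
          exact hd (mem_of_replicate_mem_prod (prodI_le.1 hle (mem_prod_opt.2
            (Or.inr ⟨d, hd', _, replicate_mem_prod_replicate (hD' hd') n, rfl⟩))))
      · exact fun D _ ↦ prodI_le.2 (prod_subset_prod_cons _ _)
  rw [mul_le_iff_of_isSuccLimit isSuccLimit_omega0]
  intro o ho
  obtain ⟨n, rfl⟩ := lt_omega0.1 ho
  refine (key n).trans (wfRank_mono_s8 (prodI_le.2 ?_))
  clear ho
  induction n with
  | zero => exact fun w hw ↦ mem_prod_nil.1 hw ▸ nil_mem_prod _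
  | succ n ih => exact prod_opt_subset_starList hCA ih

theorem omega0_opow_adjsw_le_wfRank_starList (A : Closeds X) :
    ω ^ adjsw (wfRank A) ≤ wfRank (prodI (starList A)) + 1 ∧
      (A ≠ ⊥ → ω ^ adjsw (wfRank A) ≤ wfRank (prodI (starList A))) := by
  induction A using WellFoundedLT.induction with | _ A ih => ?_
  have step : ∀ B < A, ω ^ (adjsw (wfRank B) + 1) ≤ wfRank (prodI (starList A)) := fun B hB ↦ by
    rw [opow_add_one]
    exact le_trans (by gcongr; exact (ih B hB).1) (mul_omega0_le_wfRank_starList hB)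
  by_cases hA : A = ⊥
  · refine ⟨?_, fun h ↦ absurd hA h⟩
    have h0 : wfRank A = 0 := by
      by_contra h0
      obtain ⟨B, hB, -⟩ := lt_wfRank_iff.1 (pos_iff_ne_zero.2 h0)
      simp [hA] at hB
    rw [h0, adjsw_zero, opow_zero]
    simp
  suffices h : ω ^ adjsw (wfRank A) ≤ wfRank (prodI (starList A)) from
    ⟨h.trans (by simp), fun _ ↦ h⟩
  by_cases hcrit : IsCritical (wfRank A)
  · obtain ⟨C, hCA, hC⟩ := exists_irreducibleCloseds_le_wfRank hcrit
    rw [adjsw_of_exists ⟨_, 0, hcrit, by simp⟩, opow_add_one, hcrit]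
    exact le_trans (by gcongr) (wfRank_mul_omega0_le_wfRank_starList hCA)
  obtain h0 | ⟨β, hβ⟩ | hlim := zero_or_succ_or_isSuccLimit (wfRank A)
  · have := wfRank_strictMono (bot_lt_iff_ne_bot.2 hA)
    rw [h0] at this
    simp at this
  · rw [Order.succ_eq_add_one] at hβ
    obtain ⟨B, hB, hβB⟩ := lt_wfRank_iff.1 (hβ ▸ lt_add_one β)
    rw [← hβ] at hcrit ⊢
    rw [adjsw_add_one β hcrit]
    refine le_trans (opow_le_opow_right omega0_pos ?_) (step B hB)
    gcongr
    exact adjsw_strictMono.monotone hβB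
  · rw [adjsw_of_isSuccLimit hlim hcrit, opow_le_of_isSuccLimit omega0_ne_zero hlim]
    intro β hβ
    obtain ⟨B, hB, hβB⟩ := lt_wfRank_iff.1 hβ
    refine le_trans (opow_le_opow_right omega0_pos ?_) (step B hB)
    exact hβB.trans ((le_adjsw _).trans (by simp))

theorem sobRank_eq : sobRank (WordSpace X) = wfRank (prodI (starList (⊤ : Closeds X))) + 1 := by
  let : OrderTop (IrreducibleCloseds (WordSpace X)) :=
    { top := prodI (starList ⊤), le_top := prodI_le_starList_top }
  exact ordRank_of_top

theorem wfRank_starList_top [Nonempty X] :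
    wfRank (prodI (starList (⊤ : Closeds X))) = ω ^ adjsw (stature X) := by
  refine le_antisymm ?_ ((omega0_opow_adjsw_le_wfRank_starList ⊤).2 ?_)
  · refine (wfRank_le_minWeight _).trans ((minWeight_prodI_le _).trans_eq ?_)
    rw [starList, dif_pos (show ((⊤ : Closeds X) : Set X).Nonempty from Set.univ_nonempty), weight_cons]
    exact natAdd_zero _
  · obtain ⟨x⟩ := ‹Nonempty X›
    intro h
    have : x ∈ (⊤ : Closeds X) := trivial
    rw [h] at this
    exact this

theorem wfRank_starList_top_of_isEmpty [IsEmpty X] :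
    wfRank (prodI (starList (⊤ : Closeds X))) = 0 := by
  refine le_antisymm ?_ zero_le
  refine (wfRank_le_minWeight _).trans ((minWeight_prodI_le _).trans_eq ?_)
  rw [starList, dif_neg fun ⟨x, _⟩ ↦ isEmptyElim x]
  rfl

end LowerBound

end WordSpace

end WordRank

/-- For a nonempty Noetherian space `X` with `α := ‖X‖`, the word space `X*` is Noetherian
with sobrification rank `ω ^ α̂ + 1`, where `α̂ = adjsw α`; if `X` is empty, `sob (X*) = 1`. -/
theorem sobRank_wordSpace (X : Type u) [TopologicalSpace X] [NoetherianSpace X] :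
    NoetherianSpace (WordSpace X) ∧
    (Nonempty X →
      sobRank (WordSpace X) = Ordinal.omega0 ^ adjsw (stature X) + 1) ∧
    (IsEmpty X → sobRank (WordSpace X) = 1) := by
  refine ⟨inferInstance, fun _ ↦ ?_, fun _ ↦ ?_⟩
  · rw [WordSpace.sobRank_eq, WordSpace.wfRank_starList_top]
  · rw [WordSpace.sobRank_eq, WordSpace.wfRank_starList_top_of_isEmpty, zero_add]
end
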